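/- If every factor of a recurrent infinite binary word has at most three abelian returns and at least two semi-abelian returns, then the word is balanced (1-balanced). -/

import Mathlib

/-- The factor of length `n` of the infinite word `w` starting at position `i`. -/
def wordAt {α : Type*} (w : ℕ → α) (i n : ℕ) : List α :=
  (List.range n).map (fun k => w (i + k))

/-- `u` is a factor of the infinite word `w`. -/
def IsFactorW {α : Type*} (w : ℕ → α) (u : List α) : Prop :=
  ∃ i, u = wordAt w i u.length

/-- `w` is recurrent: every factor occurs infinitely often. -/
def RecurrentW {α : Type*} (w : ℕ → α) : Prop :=
  ∀ u, IsFactorW w u → ∀ N, ∃ i, N ≤ i ∧ u = wordAt w i u.length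

/-- `w` is (purely) periodic. -/
def PeriodicW {α : Type*} (w : ℕ → α) : Prop :=
  ∃ T, 0 < T ∧ ∀ n, w (n + T) = w n

/-- `w` is ultimately periodic. -/
def UltPeriodicW {α : Type*} (w : ℕ → α) : Prop :=
  ∃ T, 0 < T ∧ ∃ n₀, ∀ n, n₀ ≤ n → w (n + T) = w n

/-- Two finite words are abelian equivalent: same number of occurrences of each letter. -/
def AbEquiv {α : Type*} [DecidableEq α] (u v : List α) : Prop :=
  ∀ a : α, u.count a = v.count a

/-- Positions of occurrences of words abelian equivalent to `u` in `w`. -/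
def abOcc {α : Type*} [DecidableEq α] (w : ℕ → α) (u : List α) : Set ℕ :=
  {i | AbEquiv (wordAt w i u.length) u}

/-- The semi-abelian returns to (the abelian class of) `u` in `w`: words extending from one
occurrence of the abelian class of `u` to the next one. -/
def semiAbReturns {α : Type*} [DecidableEq α] (w : ℕ → α) (u : List α) : Set (List α) :=
  {r | ∃ i j, i ∈ abOcc w u ∧ j ∈ abOcc w u ∧ i < j ∧
      (∀ k, i < k → k < j → k ∉ abOcc w u) ∧ r = wordAt w i (j - i)}

/-- Positions of (exact) occurrences of `u` in `w`. -/
def occW {α : Type*} [DecidableEq α] (w : ℕ → α) (u : List α) : Set ℕ :=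
  {i | u = wordAt w i u.length}

/-- The ordinary return words of `u` in `w`. -/
def returnWords {α : Type*} [DecidableEq α] (w : ℕ → α) (u : List α) : Set (List α) :=
  {r | ∃ i j, i ∈ occW w u ∧ j ∈ occW w u ∧ i < j ∧
      (∀ k, i < k → k < j → k ∉ occW w u) ∧ r = wordAt w i (j - i)}

/-- `u` has exactly `k` semi-abelian returns in `w`. -/
def ExactlyKSemiAbReturns {α : Type*} [DecidableEq α] (w : ℕ → α) (u : List α) (k : ℕ) : Prop :=
  ∃ f : Fin k → List α, Function.Injective f ∧ semiAbReturns w u = Set.range f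

/-- `u` has exactly `k` abelian returns in `w`: there are `k` pairwise non-abelian-equivalent
representatives so that every semi-abelian return is abelian equivalent to exactly one of them,
and each representative is realized. -/
def ExactlyKAbReturns {α : Type*} [DecidableEq α] (w : ℕ → α) (u : List α) (k : ℕ) : Prop :=
  ∃ f : Fin k → List α,
    (∀ i j, AbEquiv (f i) (f j) → i = j) ∧
    (∀ r ∈ semiAbReturns w u, ∃ i, AbEquiv r (f i)) ∧
    (∀ i, ∃ r ∈ semiAbReturns w u, AbEquiv r (f i))

/-- `u` has at most `k` abelian returns in `w`. -/
def AtMostKAbReturns {α : Type*} [DecidableEq α] (w : ℕ → α) (u : List α) (k : ℕ) : Prop :=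
  ∃ f : Fin k → List α, ∀ r ∈ semiAbReturns w u, ∃ i, AbEquiv r (f i)

/-- `u` has at least `k` abelian returns in `w`. -/
def AtLeastKAbReturns {α : Type*} [DecidableEq α] (w : ℕ → α) (u : List α) (k : ℕ) : Prop :=
  ∃ f : Fin k → List α,
    (∀ i j, AbEquiv (f i) (f j) → i = j) ∧
    (∀ i, ∃ r ∈ semiAbReturns w u, AbEquiv r (f i))

/-- `u` has at least two semi-abelian returns in `w`. -/
def AtLeastTwoSemiAbReturns {α : Type*} [DecidableEq α] (w : ℕ → α) (u : List α) : Prop :=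
  ∃ r₁ r₂, r₁ ∈ semiAbReturns w u ∧ r₂ ∈ semiAbReturns w u ∧ r₁ ≠ r₂

/-- The factor complexity of `w`. -/
noncomputable def complexityW {α : Type*} (w : ℕ → α) (n : ℕ) : ℕ :=
  {u : List α | u.length = n ∧ IsFactorW w u}.ncard

/-- A Sturmian word: aperiodic binary word with factor complexity `n + 1`. -/
def SturmianW (w : ℕ → Bool) : Prop :=
  ¬ UltPeriodicW w ∧ ∀ n, complexityW w n = n + 1

/-- Right special factor of a binary word. -/
def RightSpecial (w : ℕ → Bool) (B : List Bool) : Prop :=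
  IsFactorW w (B ++ [false]) ∧ IsFactorW w (B ++ [true])

/-- Left special factor of a binary word. -/
def LeftSpecial (w : ℕ → Bool) (B : List Bool) : Prop :=
  IsFactorW w (false :: B) ∧ IsFactorW w (true :: B)

/-- Bispecial factor of a binary word. -/
def Bispecial (w : ℕ → Bool) (B : List Bool) : Prop :=
  RightSpecial w B ∧ LeftSpecial w B

/-- `w` is `c`-balanced. -/
def CBalanced {α : Type*} [DecidableEq α] (w : ℕ → α) (c : ℕ) : Prop :=
  ∀ u v : List α, IsFactorW w u → IsFactorW w v → u.length = v.length →
    ∀ a : α, |((u.count a : ℤ) - (v.count a : ℤ))| ≤ (c : ℤ)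

/-- Number of letters `true` among the first `n` letters of `w`. -/
def cnt (w : ℕ → Bool) : ℕ → ℕ
  | 0 => 0
  | n + 1 => cnt w n + (w n).toNat

theorem cnt_succ (w : ℕ → Bool) (n : ℕ) : cnt w (n + 1) = cnt w n + (w n).toNat := rfl

theorem cnt_succ_true {w : ℕ → Bool} {n : ℕ} (h : w n = true) : cnt w (n + 1) = cnt w n + 1 := by
  simp [cnt_succ, h]

theorem cnt_succ_false {w : ℕ → Bool} {n : ℕ} (h : w n = false) : cnt w (n + 1) = cnt w n := by
  simp [cnt_succ, h]

theorem cnt_mono (w : ℕ → Bool) : Monotone (cnt w) :=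
  monotone_nat_of_le_succ fun n => by simp [cnt_succ]

theorem cnt_add_le (w : ℕ → Bool) (i n : ℕ) : cnt w (i + n) ≤ cnt w i + n := by
  induction n with
  | zero => simp
  | succ n ih =>
    have := cnt_succ w (i + n)
    have := Bool.toNat_le (w (i + n))
    rw [← add_assoc]
    omega

theorem cnt_le_add (w : ℕ → Bool) (i n : ℕ) : cnt w i ≤ cnt w (i + n) :=
  cnt_mono w (Nat.le_add_right i n)

theorem cnt_agree {w v : ℕ → Bool} {i j n : ℕ} (h : ∀ k < n, w (i + k) = v (j + k)) :
    cnt w (i + n) + cnt v j = cnt v (j + n) + cnt w i := by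
  induction n with
  | zero => simp [add_comm]
  | succ n ih =>
    have h1 := ih fun k hk => h k (by omega)
    have h2 := h n (by omega)
    rw [← add_assoc, ← add_assoc, cnt_succ, cnt_succ, h2]
    omega

theorem cnt_add_false {w : ℕ → Bool} {i n : ℕ} (h : ∀ k < n, w (i + k) = false) :
    cnt w (i + n) = cnt w i := by
  induction n with
  | zero => rfl
  | succ n ih => rw [← add_assoc, cnt_succ_false (h n (by omega)), ih fun k hk => h k (by omega)]

theorem cnt_add_true {w : ℕ → Bool} {i n : ℕ} (h : ∀ k < n, w (i + k) = true) :
    cnt w (i + n) = cnt w i + n := by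
  induction n with
  | zero => rfl
  | succ n ih =>
    rw [← add_assoc, cnt_succ_true (h n (by omega)), ih fun k hk => h k (by omega), add_assoc]

/-- The window of length `L` of `w` starting at `i` contains exactly `c` letters `true`. -/
def Occ (w : ℕ → Bool) (L c i : ℕ) : Prop := cnt w (i + L) = cnt w i + c

/-- `i < j` are consecutive starting points of windows of length `L` with `c` letters `true`. -/
def Cons (w : ℕ → Bool) (L c i j : ℕ) : Prop :=
  Occ w L c i ∧ Occ w L c j ∧ i < j ∧ ∀ k, i < k → k < j → ¬ Occ w L c k

/-- The abelian class of length `L` with `c` letters `true` has a return of length `l`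
with `k` letters `true`. -/
def Ret (w : ℕ → Bool) (L c l k : ℕ) : Prop :=
  ∃ i, Cons w L c i (i + l) ∧ cnt w (i + l) = cnt w i + k

/-- The abelian class has at least four abelian returns. -/
def Four (w : ℕ → Bool) (L c : ℕ) : Prop :=
  ∃ t : Fin 4 → ℕ × ℕ, Function.Injective t ∧ ∀ n, Ret w L c (t n).1 (t n).2

/-- The word is eventually periodic and the abelian class occurs once per period. -/
def Single (w : ℕ → Bool) (L c : ℕ) : Prop :=
  (∃ i, Occ w L c i) ∧ ∃ N d, 0 < d ∧ (∀ i, N ≤ i → w (i + d) = w i) ∧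
    ∀ i j, N ≤ i → i < j → Occ w L c i → Occ w L c j → i + d ≤ j

/-- The number `c` is the least, or the greatest, number of letters `true` in windows
of length `L`. -/
def Extr (w : ℕ → Bool) (L c : ℕ) : Prop :=
  (∀ i, cnt w i + c ≤ cnt w (i + L)) ∨ ∀ i, cnt w (i + L) ≤ cnt w i + c

/-- Some extremal abelian class has four abelian returns or a single semi-abelian return. -/
def Bad (w : ℕ → Bool) : Prop :=
  ∃ L c, 0 < L ∧ Extr w L c ∧ (Four w L c ∨ Single w L c)

/-- Recurrence in terms of positions. -/
def Rec (w : ℕ → Bool) : Prop :=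
  ∀ i n N, ∃ j, N ≤ j ∧ ∀ k < n, w (j + k) = w (i + k)

theorem Four.mk {w : ℕ → Bool} {L c l₁ k₁ l₂ k₂ l₃ k₃ l₄ k₄ : ℕ}
    (h₁ : Ret w L c l₁ k₁) (h₂ : Ret w L c l₂ k₂) (h₃ : Ret w L c l₃ k₃) (h₄ : Ret w L c l₄ k₄)
    (h₁₂ : l₁ ≠ l₂ ∨ k₁ ≠ k₂) (h₁₃ : l₁ ≠ l₃ ∨ k₁ ≠ k₃) (h₁₄ : l₁ ≠ l₄ ∨ k₁ ≠ k₄)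
    (h₂₃ : l₂ ≠ l₃ ∨ k₂ ≠ k₃) (h₂₄ : l₂ ≠ l₄ ∨ k₂ ≠ k₄) (h₃₄ : l₃ ≠ l₄ ∨ k₃ ≠ k₄) :
    Four w L c := by
  refine ⟨![(l₁, k₁), (l₂, k₂), (l₃, k₃), (l₄, k₄)], ?_, ?_⟩
  · intro a b hab
    fin_cases a <;> fin_cases b <;> simp at hab ⊢ <;> omega
  · intro n
    fin_cases n <;> assumption

theorem length_wordAt {α : Type*} (w : ℕ → α) (i n : ℕ) : (wordAt w i n).length = n := by
  simp [wordAt]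

theorem wordAt_succ {α : Type*} (w : ℕ → α) (i n : ℕ) :
    wordAt w i (n + 1) = wordAt w i n ++ [w (i + n)] := by
  simp [wordAt, List.range_succ]

theorem wordAt_eq_iff {α : Type*} {w : ℕ → α} {i j n : ℕ} :
    wordAt w i n = wordAt w j n ↔ ∀ k < n, w (i + k) = w (j + k) := by
  simp [wordAt]

theorem count_true_wordAt (w : ℕ → Bool) (i n : ℕ) :
    cnt w i + (wordAt w i n).count true = cnt w (i + n) := by
  induction n with
  | zero => simp [wordAt]
  | succ n ih =>
    rw [wordAt_succ, List.count_append, ← add_assoc, ← add_assoc, ih, cnt_succ]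
    cases w (i + n) <;> simp

theorem count_false_wordAt (w : ℕ → Bool) (i n : ℕ) :
    (wordAt w i n).count false + (wordAt w i n).count true = n := by
  induction n with
  | zero => simp [wordAt]
  | succ n ih =>
    rw [wordAt_succ, List.count_append, List.count_append]
    cases w (i + n) <;> simp <;> omega

theorem abEquiv_iff {w v : ℕ → Bool} {i j n m : ℕ} :
    AbEquiv (wordAt w i n) (wordAt v j m) ↔
      n = m ∧ cnt w (i + n) + cnt v j = cnt v (j + m) + cnt w i := by
  have h1 := count_true_wordAt w i n
  have h2 := count_true_wordAt v j m
  have h3 := count_false_wordAt w i n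
  have h4 := count_false_wordAt v j m
  unfold AbEquiv
  rw [Bool.forall_bool]
  omega

theorem mem_abOcc {w : ℕ → Bool} {L c i₀ : ℕ} (h₀ : Occ w L c i₀) (i : ℕ) :
    i ∈ abOcc w (wordAt w i₀ L) ↔ Occ w L c i := by
  unfold Occ at *
  simp only [abOcc, Set.mem_ofPred_eq, length_wordAt, abEquiv_iff, true_and]
  omega

theorem isFactorW_wordAt {α : Type*} (w : ℕ → α) (i n : ℕ) : IsFactorW w (wordAt w i n) :=
  ⟨i, by rw [length_wordAt]⟩

theorem rec_of_recurrentW {w : ℕ → Bool} (h : RecurrentW w) : Rec w := by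
  intro i n N
  obtain ⟨j, hj, e⟩ := h _ (isFactorW_wordAt w i n) N
  rw [length_wordAt, wordAt_eq_iff] at e
  exact ⟨j, hj, fun k hk => (e k hk).symm⟩

theorem not_four_of_atMost {w : ℕ → Bool}
    (h : ∀ u, IsFactorW w u → u ≠ [] → AtMostKAbReturns w u 3) {L c : ℕ} (hL : 0 < L) :
    ¬ Four w L c := by
  rintro ⟨t, ht, hr⟩
  obtain ⟨i₀, hi₀, -⟩ := hr 0
  obtain ⟨f, hf⟩ := h (wordAt w i₀ L) (isFactorW_wordAt w i₀ L)
    (by rw [← List.length_pos_iff, length_wordAt]; exact hL)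
  choose p hp using hr
  have key : ∀ n, ∃ g, AbEquiv (wordAt w (p n) (t n).1) (f g) := by
    intro n
    refine hf _ ⟨p n, p n + (t n).1, ?_, ?_, (hp n).1.2.2.1, ?_, by simp⟩
    · exact (mem_abOcc hi₀.1 _).2 (hp n).1.1
    · exact (mem_abOcc hi₀.1 _).2 (hp n).1.2.1
    · intro k hk hk' hmem
      exact (hp n).1.2.2.2 k hk hk' ((mem_abOcc hi₀.1 _).1 hmem)
  choose g hg using key
  obtain ⟨a, b, hab, e⟩ := Fintype.exists_ne_map_eq_of_card_lt g (by simp)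
  have : AbEquiv (wordAt w (p a) (t a).1) (wordAt w (p b) (t b).1) := fun x => by
    rw [hg a x, hg b x, e]
  obtain ⟨h1, h2⟩ := abEquiv_iff.1 this
  refine hab (ht (Prod.ext h1 ?_))
  have := (hp a).2
  have := (hp b).2
  omega

theorem occ_of_agree {w : ℕ → Bool} {L c i j : ℕ} (h : ∀ k < L, w (j + k) = w (i + k)) :
    Occ w L c i ↔ Occ w L c j := by
  have := cnt_agree h
  unfold Occ
  omega

theorem Cons.of_agree {w : ℕ → Bool} {L c i j l : ℕ} (h : Cons w L c i (i + l))
    (e : ∀ k < l + L, w (j + k) = w (i + k)) : Cons w L c j (j + l) := by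
  have key : ∀ m ≤ l, Occ w L c (i + m) ↔ Occ w L c (j + m) := by
    intro m hm
    refine occ_of_agree fun k hk => ?_
    have := e (m + k) (by omega)
    simpa [add_assoc] using this
  obtain ⟨h1, h2, h3, h4⟩ := h
  refine ⟨?_, (key l le_rfl).1 h2, by omega, ?_⟩
  · simpa using (key 0 (by omega)).1 (by simpa using h1)
  · intro k hk hk' ho
    obtain ⟨m, rfl⟩ : ∃ m, k = j + m := ⟨k - j, by omega⟩
    exact h4 (i + m) (by omega) (by omega) ((key m (by omega)).2 ho)

theorem Rec.exists_occ {w : ℕ → Bool} (hw : Rec w) {L c i : ℕ} (h : Occ w L c i) (N : ℕ) :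
    ∃ j, N ≤ j ∧ Occ w L c j := by
  obtain ⟨j, hj, e⟩ := hw i L N
  exact ⟨j, hj, (occ_of_agree e).1 h⟩

theorem periodic_mul {w : ℕ → Bool} {N d : ℕ} (h : ∀ i, N ≤ i → w (i + d) = w i) (m i : ℕ)
    (hi : N ≤ i) : w (i + m * d) = w i := by
  induction m with
  | zero => simp
  | succ m ih =>
    rw [← ih, Nat.succ_mul, ← add_assoc]
    exact h _ (by omega)

theorem not_single_of_atLeast {w : ℕ → Bool} (hw : Rec w)
    (h : ∀ u, IsFactorW w u → u ≠ [] → AtLeastTwoSemiAbReturns w u) {L c : ℕ} (hL : 0 < L) :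
    ¬ Single w L c := by
  rintro ⟨⟨i₀, hi₀⟩, N, d, hd, hper, hgap⟩
  obtain ⟨r₁, r₂, ⟨i, i', hi, hi', hlt, hno, rfl⟩, ⟨j, j', hj, hj', hlt', hno', rfl⟩, hne⟩ :=
    h (wordAt w i₀ L) (isFactorW_wordAt w i₀ L)
      (by rw [← List.length_pos_iff, length_wordAt]; exact hL)
  rw [mem_abOcc hi₀] at hi hi' hj hj'
  simp only [mem_abOcc hi₀] at hno hno'
  have shift : ∀ x x', Occ w L c x → Occ w L c x' → x < x' →
      (∀ k, x < k → k < x' → ¬ Occ w L c k) → ∃ y, N ≤ y ∧ Occ w L c y ∧ x' - x = d ∧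
      ∀ k < d, w (y + k) = w (x + k) := by
    intro x x' hx hx' hxx hk
    have hc : Cons w L c x (x + (x' - x)) := by
      rw [Nat.add_sub_cancel' hxx.le]
      exact ⟨hx, hx', hxx, hk⟩
    obtain ⟨y, hy, e⟩ := hw x (x' - x + L) N
    have hc' := hc.of_agree e
    have ho : Occ w L c (y + d) := by
      refine (occ_of_agree fun k _ => ?_).1 hc'.1
      rw [show y + d + k = y + k + d by omega]
      exact hper _ (by omega)
    have h1 := hgap y (y + (x' - x)) hy hc'.2.2.1 hc'.1 hc'.2.1
    have h2 : x' - x = d := by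
      by_contra hcon
      exact hc'.2.2.2 (y + d) (by omega) (by omega) ho
    exact ⟨y, hy, hc'.1, h2, fun k hk => e k (by omega)⟩
  obtain ⟨y, hy, hyo, hl, e⟩ := shift i i' hi hi' hlt hno
  obtain ⟨y', hy', hyo', hl', e'⟩ := shift j j' hj hj' hlt' hno'
  apply hne
  rw [hl, hl', wordAt_eq_iff]
  have main : ∀ s s', N ≤ s → s ≤ s' → Occ w L c s → Occ w L c s' → ∃ m, s' = s + m * d := by
    intro s s' hs hss ho ho'
    refine ⟨(s' - s) / d, ?_⟩
    by_contra hcon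
    have h1 := Nat.div_add_mod (s' - s) d
    have h2 := Nat.mod_lt (s' - s) hd
    rw [mul_comm] at h1
    set q := (s' - s) / d
    have ho2 : Occ w L c (s + q * d) := by
      refine (occ_of_agree fun k _ => ?_).1 ho
      rw [show s + q * d + k = s + k + q * d by omega]
      exact periodic_mul hper _ _ (by omega)
    have := hgap (s + q * d) s' (by omega) (by omega) ho2 ho'
    omega
  intro k hk
  rw [← e k hk, ← e' k hk]
  rcases le_total y y' with hle | hle
  · obtain ⟨m, rfl⟩ := main y y' hy hle hyo hyo'
    rw [show y + m * d + k = y + k + m * d by omega, periodic_mul hper _ _ (by omega)]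
  · obtain ⟨m, rfl⟩ := main y' y hy' hle hyo' hyo
    rw [show y' + m * d + k = y' + k + m * d by omega, periodic_mul hper _ _ (by omega)]

theorem exists_unbalanced {w : ℕ → Bool} (h : ¬ CBalanced w 1) :
    ∃ n i j, cnt w (i + n) + cnt w j + 2 ≤ cnt w (j + n) + cnt w i := by
  by_contra! hcon
  apply h
  rintro u v ⟨i, hu⟩ ⟨j, hv⟩ hl a
  rw [← hl] at hv
  set n := u.length
  have h1 := count_true_wordAt w i n
  have h2 := count_true_wordAt w j n
  have h3 := count_false_wordAt w i n
  have h4 := count_false_wordAt w j n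
  have h5 := hcon n i j
  have h6 := hcon n j i
  rw [← hu] at h1 h3
  rw [← hv] at h2 h4
  rw [abs_le]
  cases a <;> constructor <;> push_cast <;> omega

theorem Ret.le {w : ℕ → Bool} {L c l k : ℕ} (h : Ret w L c l k) : k ≤ l := by
  obtain ⟨i, -, h⟩ := h
  have := cnt_add_le w i l
  omega

theorem Ret.pos {w : ℕ → Bool} {L c l k : ℕ} (h : Ret w L c l k) : 0 < l := by
  obtain ⟨i, ⟨-, -, h, -⟩, -⟩ := h
  omega

theorem Occ.le {w : ℕ → Bool} {L c i : ℕ} (h : Occ w L c i) : c ≤ L := by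
  have := cnt_add_le w i L
  unfold Occ at h
  omega

theorem Four.map {z w : ℕ → Bool} {L c L' c' : ℕ} (h : Four z L c) (g : ℕ → ℕ → ℕ × ℕ)
    (hg : ∀ l k, Ret z L c l k → Ret w L' c' (g l k).1 (g l k).2)
    (inj : ∀ l k l' k', k ≤ l → k' ≤ l' → g l k = g l' k' → l = l' ∧ k = k') : Four w L' c' := by
  obtain ⟨t, ht, hr⟩ := h
  refine ⟨fun n => g (t n).1 (t n).2, fun m n e => ?_, fun n => hg _ _ (hr n)⟩
  have := inj _ _ _ _ (hr m).le (hr n).le e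
  exact ht (Prod.ext this.1 this.2)

theorem Four.exists_occ {w : ℕ → Bool} {L c : ℕ} (h : Four w L c) : ∃ i, Occ w L c i := by
  obtain ⟨t, -, hr⟩ := h
  obtain ⟨i, hi, -⟩ := hr 0
  exact ⟨i, hi.1⟩

theorem Bad.exists_occ {w : ℕ → Bool} {L c : ℕ} (h : Four w L c ∨ Single w L c) :
    ∃ i, Occ w L c i :=
  h.elim Four.exists_occ And.left

/-- The word with the two letters exchanged. -/
def swapLetters (w : ℕ → Bool) (n : ℕ) : Bool := !w n

theorem cnt_swapLetters (w : ℕ → Bool) (n : ℕ) : cnt (swapLetters w) n + cnt w n = n := by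
  induction n with
  | zero => rfl
  | succ n ih =>
    rw [cnt_succ, cnt_succ]
    cases h : w n <;> simp [swapLetters, h] <;> omega

theorem occ_swapLetters {w : ℕ → Bool} {L c c' i : ℕ} (h : c + c' = L) :
    Occ (swapLetters w) L c' i ↔ Occ w L c i := by
  have h1 := cnt_swapLetters w i
  have h2 := cnt_swapLetters w (i + L)
  unfold Occ
  omega

theorem cons_swapLetters {w : ℕ → Bool} {L c c' i j : ℕ} (h : c + c' = L) :
    Cons (swapLetters w) L c' i j ↔ Cons w L c i j := by
  simp only [Cons, occ_swapLetters h]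

theorem Ret.of_swapLetters {w : ℕ → Bool} {L c c' l k : ℕ} (h : c + c' = L)
    (hr : Ret (swapLetters w) L c' l k) : Ret w L c l (l - k) := by
  have := hr.le
  obtain ⟨i, h1, h2⟩ := hr
  refine ⟨i, (cons_swapLetters h).1 h1, ?_⟩
  have h3 := cnt_swapLetters w i
  have h4 := cnt_swapLetters w (i + l)
  omega

theorem Four.of_swapLetters {w : ℕ → Bool} {L c c' : ℕ} (h : c + c' = L)
    (hf : Four (swapLetters w) L c') :
    Four w L c := by
  refine hf.map (fun l k => (l, l - k)) (fun l k hr => hr.of_swapLetters h) ?_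
  intro l k l' k' h1 h2 h3
  simp only [Prod.mk.injEq] at h3
  omega

theorem Single.of_swapLetters {w : ℕ → Bool} {L c c' : ℕ} (h : c + c' = L)
    (hf : Single (swapLetters w) L c') : Single w L c := by
  obtain ⟨h1, N, d, hd, hp, ho⟩ := hf
  simp only [occ_swapLetters h] at h1 ho
  exact ⟨h1, N, d, hd, fun i hi => by simpa [swapLetters] using hp i hi, ho⟩

theorem Bad.of_swapLetters {w : ℕ → Bool} (h : Bad (swapLetters w)) : Bad w := by
  obtain ⟨L, c', hL, he, hb⟩ := h
  obtain ⟨i, hi⟩ := Bad.exists_occ hb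
  have := hi.le
  have hc : L - c' + c' = L := by omega
  refine ⟨L, L - c', hL, ?_, hb.imp (·.of_swapLetters hc) (·.of_swapLetters hc)⟩
  rcases he with he | he
  · right
    intro j
    have := he j
    have h1 := cnt_swapLetters w j
    have h2 := cnt_swapLetters w (j + L)
    omega
  · left
    intro j
    have := he j
    have h1 := cnt_swapLetters w j
    have h2 := cnt_swapLetters w (j + L)
    omega

theorem Rec.swap {w : ℕ → Bool} (h : Rec w) : Rec (swapLetters w) := by
  intro i n N
  obtain ⟨j, hj, e⟩ := h i n N
  exact ⟨j, hj, fun k hk => by simp [swapLetters, e k hk]⟩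

/-- `w` is obtained from `z`, from position `f 0` on, by replacing `false` by the word `u₀`
of length `l₀` and `true` by the word `u₁` of length `l₁`; the image of the letter of index `j`
starts at `f j`. -/
structure Coding (z w : ℕ → Bool) (f : ℕ → ℕ) (l₀ l₁ : ℕ) (u₀ u₁ : ℕ → Bool) : Prop where
  pos₀ : 0 < l₀
  pos₁ : 0 < l₁
  step₀ : ∀ {j}, z j = false → f (j + 1) = f j + l₀
  step₁ : ∀ {j}, z j = true → f (j + 1) = f j + l₁
  letter₀ : ∀ {j t}, z j = false → t < l₀ → w (f j + t) = u₀ t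
  letter₁ : ∀ {j t}, z j = true → t < l₁ → w (f j + t) = u₁ t

namespace Coding

variable {z w : ℕ → Bool} {f : ℕ → ℕ} {l₀ l₁ : ℕ} {u₀ u₁ : ℕ → Bool}

theorem strictMono (C : Coding z w f l₀ l₁ u₀ u₁) : StrictMono f :=
  strictMono_nat_of_lt_succ fun j => by
    have := C.pos₀
    have := C.pos₁
    cases h : z j
    · rw [C.step₀ h]
      omega
    · rw [C.step₁ h]
      omega

theorem locate (C : Coding z w f l₀ l₁ u₀ u₁) {x : ℕ} (hx : f 0 ≤ x) :
    ∃ j, f j ≤ x ∧ x < f (j + 1) := by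
  have h : ∃ n, x < f n := ⟨x + 1, C.strictMono.le_apply⟩
  classical
  have h1 := Nat.find_spec h
  have h2 : Nat.find h ≠ 0 := fun e => by
    rw [e] at h1
    omega
  obtain ⟨j, hj⟩ := Nat.exists_eq_succ_of_ne_zero h2
  refine ⟨j, ?_, by rwa [hj] at h1⟩
  by_contra! hc
  exact Nat.find_min h (m := j) (by omega) hc

theorem apply_add (C : Coding z w f l₀ l₁ u₀ u₁) {j m R S : ℕ} (h : Occ z m S j)
    (hm : R + S = m) : f (j + m) = f j + R * l₀ + S * l₁ := by
  unfold Occ at h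
  induction m generalizing R S with
  | zero =>
    obtain rfl : R = 0 := by omega
    obtain rfl : S = 0 := by omega
    simp
  | succ m ih =>
    have h3 := cnt_le_add z j m
    have h4 := cnt_add_le z j m
    rw [← add_assoc, cnt_succ] at h
    rw [← add_assoc]
    cases hz : z (j + m) <;> rw [hz] at h <;> simp only [Bool.toNat_false, Bool.toNat_true] at h
    · obtain ⟨R, rfl⟩ : ∃ r, R = r + 1 := ⟨R - 1, by omega⟩
      rw [C.step₀ hz, ih (R := R) h (by omega)]
      ring
    · obtain ⟨S, rfl⟩ : ∃ r, S = r + 1 := ⟨S - 1, by omega⟩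
      rw [C.step₁ hz, ih (R := R) (S := S) (by omega) (by omega)]
      ring

theorem cnt_offset₀ (C : Coding z w f l₀ l₁ u₀ u₁) {j t : ℕ} (hz : z j = false) (ht : t ≤ l₀) :
    cnt w (f j + t) = cnt w (f j) + cnt u₀ t := by
  have := @cnt_agree w u₀ (f j) 0 t fun k hk => by
    rw [zero_add]
    exact C.letter₀ hz (by omega)
  rw [zero_add] at this
  simp only [cnt] at this
  omega

theorem cnt_offset₁ (C : Coding z w f l₀ l₁ u₀ u₁) {j t : ℕ} (hz : z j = true) (ht : t ≤ l₁) :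
    cnt w (f j + t) = cnt w (f j) + cnt u₁ t := by
  have := @cnt_agree w u₁ (f j) 0 t fun k hk => by
    rw [zero_add]
    exact C.letter₁ hz (by omega)
  rw [zero_add] at this
  simp only [cnt] at this
  omega

theorem cnt_apply_add (C : Coding z w f l₀ l₁ u₀ u₁) {j m R S : ℕ} (h : Occ z m S j)
    (hm : R + S = m) : cnt w (f (j + m)) = cnt w (f j) + R * cnt u₀ l₀ + S * cnt u₁ l₁ := by
  unfold Occ at h
  induction m generalizing R S with
  | zero =>
    obtain rfl : R = 0 := by omega
    obtain rfl : S = 0 := by omega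
    simp
  | succ m ih =>
    have h3 := cnt_le_add z j m
    have h4 := cnt_add_le z j m
    rw [← add_assoc, cnt_succ] at h
    rw [← add_assoc]
    cases hz : z (j + m) <;> rw [hz] at h <;> simp only [Bool.toNat_false, Bool.toNat_true] at h
    · obtain ⟨R, rfl⟩ : ∃ r, R = r + 1 := ⟨R - 1, by omega⟩
      rw [C.step₀ hz, C.cnt_offset₀ hz le_rfl, ih (R := R) h (by omega)]
      ring
    · obtain ⟨S, rfl⟩ : ∃ r, S = r + 1 := ⟨S - 1, by omega⟩
      rw [C.step₁ hz, C.cnt_offset₁ hz le_rfl, ih (R := R) (S := S) (by omega) (by omega)]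
      ring

theorem apply_add_of_agree (C : Coding z w f l₀ l₁ u₀ u₁) {i j n : ℕ}
    (h : ∀ k < n, z (j + k) = z (i + k)) : f (j + n) + f i = f (i + n) + f j := by
  induction n with
  | zero => simp [add_comm]
  | succ n ih =>
    have h1 := ih fun k hk => h k (by omega)
    have h2 := h n (by omega)
    rw [← add_assoc, ← add_assoc]
    cases hz : z (i + n)
    · rw [C.step₀ hz, C.step₀ (h2.trans hz)]
      omega
    · rw [C.step₁ hz, C.step₁ (h2.trans hz)]
      omega

theorem letter_eq (C : Coding z w f l₀ l₁ u₀ u₁) {i j t : ℕ} (h : z j = z i)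
    (ht : f i + t < f (i + 1)) : w (f j + t) = w (f i + t) := by
  cases hz : z i
  · rw [C.step₀ hz] at ht
    rw [C.letter₀ hz (by omega), C.letter₀ (h.trans hz) (by omega)]
  · rw [C.step₁ hz] at ht
    rw [C.letter₁ hz (by omega), C.letter₁ (h.trans hz) (by omega)]

theorem periodic (C : Coding z w f l₀ l₁ u₀ u₁) {N d : ℕ} (h : ∀ j, N ≤ j → z (j + d) = z j) :
    ∃ D, (∀ j, N ≤ j → f (j + d) = f j + D) ∧ ∀ x, f N ≤ x → w (x + D) = w x := by
  have hN : f N ≤ f (N + d) := C.strictMono.monotone (by omega)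
  have h1 : ∀ j, N ≤ j → f (j + d) = f j + (f (N + d) - f N) := by
    intro j hj
    have := C.apply_add_of_agree (i := N) (j := N + d) (n := j - N) fun k _ => by
      rw [show N + d + k = N + k + d by omega]
      exact h _ (by omega)
    rw [show N + d + (j - N) = j + d by omega, show N + (j - N) = j by omega] at this
    omega
  refine ⟨f (N + d) - f N, h1, fun x hx => ?_⟩
  obtain ⟨j, hj, hj'⟩ := C.locate (x := x) ((C.strictMono.monotone (Nat.zero_le N)).trans hx)
  have hNj : N ≤ j := by
    by_contra! hc
    have := C.strictMono.monotone (show j + 1 ≤ N by omega)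
    omega
  have := C.letter_eq (i := j) (j := j + d) (t := x - f j) (h j hNj) (by omega)
  rw [h1 j hNj] at this
  rwa [show f j + (f (N + d) - f N) + (x - f j) = x + (f (N + d) - f N) by omega,
    show f j + (x - f j) = x by omega] at this

/-- If the occurrences of an abelian class of `w` are at a fixed offset of the images of the
elements of `P`, which are spaced by a period of `z`, then the class has a single return. -/
theorem single (C : Coding z w f l₀ l₁ u₀ u₁) {L c N d s M : ℕ} {P : ℕ → Prop} (hd : 0 < d)
    (h : ∀ j, N ≤ j → z (j + d) = z j)
    (hP : ∀ i j, N ≤ i → i < j → P i → P j → i + d ≤ j)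
    (ho : ∃ x, Occ w L c x) (hO : ∀ x, M ≤ x → Occ w L c x → ∃ j, P j ∧ x = f j + s) :
    Single w L c := by
  obtain ⟨D, h1, h2⟩ := C.periodic h
  refine ⟨ho, f N + s + M, D, ?_, fun i hi => h2 i (by omega), ?_⟩
  · have := h1 N le_rfl
    have := C.strictMono (show N < N + d by omega)
    omega
  · intro i j hi hij hoi hoj
    obtain ⟨a, ha, rfl⟩ := hO i (by omega) hoi
    obtain ⟨b, hb, rfl⟩ := hO j (by omega) hoj
    have hNa : N ≤ a := C.strictMono.le_iff_le.1 (by omega)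
    have hab : a < b := C.strictMono.lt_iff_lt.1 (by omega)
    have := C.strictMono.monotone (hP a b hNa hab ha hb)
    rw [h1 a hNa] at this
    omega

/-- Recurrence is inherited when the letters of `z` can be read at a fixed offset in `w` and when
image starting points are recognised by sufficiently long factors. -/
theorem recurrent (C : Coding z w f l₀ l₁ u₀ u₁) (hw : Rec w) {e : ℕ} (he : ∀ j, z j = w (f j + e))
    (sync : ∀ j, ∃ K, ∀ y, f 0 ≤ y → (∀ k < K, w (y + k) = w (f j + k)) → ∃ j', y = f j') :
    Rec z := by
  intro i n N
  obtain ⟨K, hK⟩ := sync i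
  obtain ⟨y, hy, ha⟩ := hw (f i) (K + f (i + n) + e + 1) (f N)
  obtain ⟨j, rfl⟩ := hK y ((C.strictMono.monotone (Nat.zero_le N)).trans hy)
    fun k hk => ha k (by omega)
  have main : ∀ k ≤ n, ∀ m < k, z (j + m) = z (i + m) := by
    intro k
    induction k with
    | zero => simp
    | succ k ih =>
      intro hk m hm
      rcases Nat.lt_succ_iff_lt_or_eq.1 hm with hm | rfl
      · exact ih (by omega) m hm
      · have h1 := C.apply_add_of_agree (ih (by omega))
        have h2 := C.strictMono.monotone (show i ≤ i + m by omega)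
        have h3 := C.strictMono.monotone (show j ≤ j + m by omega)
        have h4 := C.strictMono.monotone (show i + m ≤ i + n by omega)
        have h5 := ha (f (i + m) - f i + e) (by omega)
        rw [he, he]
        rwa [show f j + (f (i + m) - f i + e) = f (j + m) + e by omega,
          show f i + (f (i + m) - f i + e) = f (i + m) + e by omega] at h5
  exact ⟨j, C.strictMono.le_iff_le.1 hy, main n le_rfl⟩

/-- Consecutive elements of `P` give consecutive occurrences of a class whose occurrences are at
a fixed offset of the images of the elements of `P`. -/
theorem cons (C : Coding z w f l₀ l₁ u₀ u₁) {L c s : ℕ} {P : ℕ → Prop}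
    (hO : ∀ x, f 0 + s ≤ x → (Occ w L c x ↔ ∃ j, P j ∧ x = f j + s)) {i j : ℕ} (hi : P i)
    (hj : P j) (hij : i < j) (hn : ∀ k, i < k → k < j → ¬ P k) :
    Cons w L c (f i + s) (f j + s) := by
  have h1 := C.strictMono hij
  have h0 := C.strictMono.monotone (Nat.zero_le i)
  refine ⟨(hO _ (by omega)).2 ⟨i, hi, rfl⟩, (hO _ (by omega)).2 ⟨j, hj, rfl⟩, by omega, ?_⟩
  intro x hx hx' ho
  obtain ⟨k, hk, rfl⟩ := (hO x (by omega)).1 ho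
  exact hn k (C.strictMono.lt_iff_lt.1 (by omega)) (C.strictMono.lt_iff_lt.1 (by omega)) hk

end Coding

/-- `w` contains a maximal run of exactly `k` letters `x`. -/
def Run (w : ℕ → Bool) (x : Bool) (k : ℕ) : Prop :=
  0 < k ∧ ∃ i, w i = !x ∧ (∀ t < k, w (i + 1 + t) = x) ∧ w (i + 1 + k) = !x

theorem Rec.exists_eq {w : ℕ → Bool} (hw : Rec w) (a N : ℕ) : ∃ j, N ≤ j ∧ w j = w a := by
  obtain ⟨j, hj, e⟩ := hw a 1 N
  exact ⟨j, hj, e 0 one_pos⟩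

theorem Rec.next {w : ℕ → Bool} (hw : Rec w) {a : ℕ} {x : Bool} (h : w a = x) (i : ℕ) :
    ∃ k, (∀ t < k, w (i + t) = !x) ∧ w (i + k) = x := by
  have h1 : ∃ k, w (i + k) = x := by
    obtain ⟨j, hj, e⟩ := hw.exists_eq a i
    exact ⟨j - i, by rw [Nat.add_sub_cancel' hj, e, h]⟩
  classical
  refine ⟨Nat.find h1, fun t ht => ?_, Nat.find_spec h1⟩
  have := Nat.find_min h1 ht
  cases h2 : w (i + t) <;> cases x <;> simp_all

theorem Rec.exists_boundary {w : ℕ → Bool} (hw : Rec w) {a b : ℕ} {x : Bool} (ha : w a = !x)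
    (hb : w b = x) (N : ℕ) : ∃ i, N ≤ i ∧ w i = !x ∧ w (i + 1) = x := by
  obtain ⟨i, hi, e⟩ := hw.exists_eq a N
  obtain ⟨k, h1, h2⟩ := hw.next hb i
  have hk : k ≠ 0 := by
    rintro rfl
    rw [add_zero, e, ha] at h2
    cases x <;> simp at h2
  obtain ⟨k, rfl⟩ := Nat.exists_eq_succ_of_ne_zero hk
  exact ⟨i + k, by omega, h1 k (by omega), by rw [← h2]; congr 1⟩

theorem Rec.run_at {w : ℕ → Bool} (hw : Rec w) {x : Bool} {i : ℕ} (hi : w i = !x)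
    (hi' : w (i + 1) = x) :
    ∃ k, Run w x k ∧ (∀ t < k, w (i + 1 + t) = x) ∧ w (i + 1 + k) = !x := by
  obtain ⟨k, h1, h2⟩ := hw.next hi (i + 1)
  simp only [Bool.not_not] at h1
  refine ⟨k, ⟨Nat.pos_of_ne_zero ?_, i, hi, h1, h2⟩, h1, h2⟩
  rintro rfl
  rw [add_zero, hi'] at h2
  cases x <;> simp at h2

theorem Rec.exists_run {w : ℕ → Bool} (hw : Rec w) {a b : ℕ} {x : Bool} (ha : w a = !x)
    (hb : w b = x) : ∃ k, Run w x k := by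
  obtain ⟨i, -, h1, h2⟩ := hw.exists_boundary ha hb 0
  obtain ⟨k, hk, -⟩ := hw.run_at h1 h2
  exact ⟨k, hk⟩

theorem Rec.le_of_ge {w : ℕ → Bool} (hw : Rec w) {L c N : ℕ}
    (h : ∀ x, N ≤ x → cnt w (x + L) ≤ cnt w x + c) (x : ℕ) : cnt w (x + L) ≤ cnt w x + c := by
  obtain ⟨j, hj, e⟩ := hw x L N
  have := cnt_agree e
  have := h j hj
  omega

theorem Rec.ge_of_ge {w : ℕ → Bool} (hw : Rec w) {L c N : ℕ}
    (h : ∀ x, N ≤ x → cnt w x + c ≤ cnt w (x + L)) (x : ℕ) : cnt w x + c ≤ cnt w (x + L) := by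
  obtain ⟨j, hj, e⟩ := hw x L N
  have := cnt_agree e
  have := h j hj
  omega

theorem Ret.of_cons {w : ℕ → Bool} {L c i j k : ℕ} (h : Cons w L c i j)
    (hk : cnt w j = cnt w i + k) : Ret w L c (j - i) k := by
  have := h.2.2.1
  refine ⟨i, ?_⟩
  rw [Nat.add_sub_cancel' this.le]
  exact ⟨h, hk⟩

theorem four_of_unbounded {w : ℕ → Bool} {L c : ℕ} (h : ∀ n, ∃ l k, n ≤ l ∧ Ret w L c l k) :
    Four w L c := by
  obtain ⟨l₁, k₁, -, h₁⟩ := h 0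
  obtain ⟨l₂, k₂, h2, h₂⟩ := h (l₁ + 1)
  obtain ⟨l₃, k₃, h3, h₃⟩ := h (l₂ + 1)
  obtain ⟨l₄, k₄, h4, h₄⟩ := h (l₃ + 1)
  refine Four.mk h₁ h₂ h₃ h₄ ?_ ?_ ?_ ?_ ?_ ?_ <;> omega

theorem occ_one_zero {w : ℕ → Bool} {i : ℕ} : Occ w 1 0 i ↔ w i = false := by
  unfold Occ
  rw [cnt_succ]
  cases w i <;> simp

theorem occ_full {w : ℕ → Bool} {p i : ℕ} : Occ w p p i ↔ ∀ t < p, w (i + t) = true := by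
  refine ⟨fun h t ht => ?_, cnt_add_true⟩
  by_contra! hc
  simp only [ne_eq, Bool.not_eq_true] at hc
  have h1 := cnt_succ_false hc
  have h2 := cnt_add_le w i t
  have h3 := cnt_add_le w (i + t + 1) (p - (t + 1))
  rw [show i + t + 1 + (p - (t + 1)) = i + p by omega] at h3
  unfold Occ at h
  omega

theorem occ_zero {w : ℕ → Bool} {p i : ℕ} : Occ w p 0 i ↔ ∀ t < p, w (i + t) = false := by
  refine ⟨fun h t ht => ?_, cnt_add_false⟩
  by_contra! hc
  simp only [ne_eq, Bool.not_eq_false] at hc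
  have h1 := cnt_succ_true hc
  have h2 := cnt_le_add w i t
  have h3 := cnt_le_add w (i + t + 1) (p - (t + 1))
  rw [show i + t + 1 + (p - (t + 1)) = i + p by omega] at h3
  unfold Occ at h
  omega

theorem ret_one_zero_of_run {w : ℕ → Bool} {m : ℕ} (h : Run w true m) : Ret w 1 0 (m + 1) m := by
  obtain ⟨hm, i, h1, h2, h3⟩ := h
  have h4 : cnt w (i + 1 + m) = cnt w (i + 1) + m := cnt_add_true h2
  have h5 := cnt_succ_false h1
  refine ⟨i, ⟨occ_one_zero.2 h1, occ_one_zero.2 ?_, by omega, ?_⟩, ?_⟩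
  · rw [show i + (m + 1) = i + 1 + m by omega, h3]
    rfl
  · intro k hk hk' ho
    have := h2 (k - (i + 1)) (by omega)
    rw [show i + 1 + (k - (i + 1)) = k by omega, occ_one_zero.1 ho] at this
    simp at this
  · rw [show i + (m + 1) = i + 1 + m by omega]
    omega

theorem cons_succ {w : ℕ → Bool} {L c i : ℕ} (h : Occ w L c i) (h' : Occ w L c (i + 1)) :
    Cons w L c i (i + 1) :=
  ⟨h, h', by omega, by omega⟩

theorem ret_one_of_false {w : ℕ → Bool} {L c i : ℕ} (h : Occ w L c i) (h' : Occ w L c (i + 1))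
    (hi : w i = false) : Ret w L c 1 0 :=
  ⟨i, cons_succ h h', cnt_succ_false hi⟩

theorem ret_one_of_true {w : ℕ → Bool} {L c i : ℕ} (h : Occ w L c i) (h' : Occ w L c (i + 1))
    (hi : w i = true) : Ret w L c 1 1 :=
  ⟨i, cons_succ h h', cnt_succ_true hi⟩

theorem cnt_decide_le (A t : ℕ) : cnt (fun t => decide (A ≤ t)) t = t - A := by
  induction t with
  | zero => simp [cnt]
  | succ t ih =>
    rw [cnt_succ, ih]
    by_cases h : A ≤ t <;> simp [h] <;> omega

/-- The word `z` is coded by `y`, with `false` standing for `A` letters `false` followed by `b`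
letters `true` and `true` for `A` letters `false` followed by `B` letters `true`. -/
abbrev RunCoding (y z : ℕ → Bool) (f : ℕ → ℕ) (A b B : ℕ) : Prop :=
  Coding y z f (A + b) (A + B) (fun t => decide (A ≤ t)) (fun t => decide (A ≤ t))

/-- Starting points of the images of the letters in a `RunCoding`. -/
def runStart (z : ℕ → Bool) (A b B p : ℕ) : ℕ → ℕ
  | 0 => p
  | j + 1 => runStart z A b B p j + A + if z (runStart z A b B p j + A + b) then B else b

theorem exists_runCoding {z : ℕ → Bool} (hz : Rec z) {A b B i : ℕ} (hA : 0 < A) (hb : 0 < b)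
    (hbB : b ≤ B) (h0 : ∀ k, Run z false k → k = A) (h1 : ∀ k, Run z true k → k = b ∨ k = B)
    (hi : z i = true) (hi' : z (i + 1) = false) :
    ∃ y f, RunCoding y z f A b B ∧ ∀ j, y j = z (f j + (A + b)) := by
  set f := runStart z A b B (i + 1) with hf
  have hs : ∀ j, f (j + 1) = f j + A + if z (f j + A + b) then B else b := fun j => rfl
  have key : ∀ q, (∃ i, q = i + 1 ∧ z i = true ∧ z (i + 1) = false) →
      (∀ t < A, z (q + t) = false) ∧
      (∀ t < if z (q + A + b) then B else b, z (q + A + t) = true) ∧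
      (∃ i, q + A + (if z (q + A + b) then B else b) = i + 1 ∧ z i = true ∧
        z (i + 1) = false) := by
    rintro q ⟨i, rfl, h2, h3⟩
    obtain ⟨k, hk, h4, h5⟩ := hz.run_at (x := false) h2 h3
    obtain rfl := h0 k hk
    obtain ⟨k', rfl⟩ : ∃ k', k = k' + 1 := ⟨k - 1, by omega⟩
    have h6 : z (i + 1 + k') = false := h4 k' (by omega)
    obtain ⟨m, hm, h7, h8⟩ := hz.run_at (x := true) (i := i + 1 + k') h6 h5
    have hmp := hm.1
    have hm' : m = if z (i + 1 + (k' + 1) + b) then B else b := by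
      rcases h1 m hm with rfl | rfl
      · rw [if_neg]
        rw [show i + 1 + (k' + 1) + m = i + 1 + k' + 1 + m by omega, h8]
        simp
      · rcases hbB.eq_or_lt with rfl | hlt
        · simp
        · rw [if_pos]
          have := h7 b hlt
          rwa [show i + 1 + k' + 1 + b = i + 1 + (k' + 1) + b by omega] at this
    rw [← hm']
    refine ⟨h4, h7, ⟨i + 1 + k' + m, by omega, ?_, ?_⟩⟩
    · have := h7 (m - 1) (by omega)
      rwa [show i + 1 + k' + 1 + (m - 1) = i + 1 + k' + m by omega] at this
    · rw [show i + 1 + k' + m + 1 = i + 1 + k' + 1 + m by omega, h8]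
      rfl
  have main : ∀ j, ∃ i, f j = i + 1 ∧ z i = true ∧ z (i + 1) = false := by
    intro j
    induction j with
    | zero => exact ⟨i, rfl, hi, hi'⟩
    | succ j ih =>
      rw [hs]
      exact (key _ ih).2.2
  have hlet : ∀ j t, t < A + (if z (f j + A + b) then B else b) →
      z (f j + t) = decide (A ≤ t) := by
    intro j t ht
    by_cases hAt : A ≤ t
    · have := (key _ (main j)).2.1 (t - A) (by omega)
      rw [show f j + A + (t - A) = f j + t by omega] at this
      simp [this, hAt]
    · simp [(key _ (main j)).1 t (by omega), hAt]
  refine ⟨fun j => z (f j + A + b), f, ⟨by omega, by omega, ?_, ?_, ?_, ?_⟩, fun j => by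
    simp only [add_assoc]⟩
  · intro j hj
    rw [hs, hj]
    simp [add_assoc]
  · intro j hj
    rw [hs, hj]
    simp [add_assoc]
  · intro j t hj ht
    refine hlet j t ?_
    rw [hj]
    exact ht
  · intro j t hj ht
    refine hlet j t ?_
    rw [hj]
    exact ht

namespace RunCoding

variable {y z : ℕ → Bool} {f : ℕ → ℕ} {A b B : ℕ}

theorem apply_succ (C : RunCoding y z f A b B) (j : ℕ) :
    f (j + 1) = f j + A + if y j then B else b := by
  cases h : y j
  · simp [C.step₀ h, add_assoc]
  · simp [C.step₁ h, add_assoc]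

theorem cnt_offset (C : RunCoding y z f A b B) {j t : ℕ} (ht : f j + t ≤ f (j + 1)) :
    cnt z (f j + t) = cnt z (f j) + (t - A) := by
  rw [← cnt_decide_le]
  cases h : y j
  · rw [C.step₀ h] at ht
    exact C.cnt_offset₀ h (by omega)
  · rw [C.step₁ h] at ht
    exact C.cnt_offset₁ h (by omega)

theorem letter (C : RunCoding y z f A b B) {j t : ℕ} (ht : f j + t < f (j + 1)) :
    z (f j + t) = decide (A ≤ t) := by
  cases h : y j
  · rw [C.step₀ h] at ht
    exact C.letter₀ h (by omega)
  · rw [C.step₁ h] at ht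
    exact C.letter₁ h (by omega)

theorem cnt_offset_le (C : RunCoding y z f A b B) (j t : ℕ) :
    cnt z (f j + t) ≤ cnt z (f j) + (t - A) := by
  have h1 := C.apply_succ j
  rcases le_total t A with h | h
  · rw [C.cnt_offset (by omega)]
  · have h2 := C.cnt_offset (j := j) (t := A) (by omega)
    have h3 := cnt_add_le z (f j + A) (t - A)
    rw [show f j + A + (t - A) = f j + t by omega] at h3
    omega

theorem le_cnt_offset (C : RunCoding y z f A b B) (hbB : b ≤ B) (j t : ℕ) :
    cnt z (f j) + min (t - A) b ≤ cnt z (f j + t) := by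
  have h1 := C.apply_succ j
  have h4 : b ≤ if y j then B else b := by
    split <;> omega
  rcases le_total t (A + b) with h | h
  · rw [C.cnt_offset (by omega)]
    omega
  · have h2 := C.cnt_offset (j := j) (t := A + b) (by omega)
    have h3 := cnt_le_add z (f j + (A + b)) (t - (A + b))
    rw [show f j + (A + b) + (t - (A + b)) = f j + t by omega] at h3
    omega

theorem window (C : RunCoding y z f A b B) (hbB : b ≤ B) {j m S : ℕ} (h : Occ y m S j) :
    f (j + m) = f j + m * A + (m * b + S * (B - b)) ∧
      cnt z (f (j + m)) = cnt z (f j) + (m * b + S * (B - b)) := by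
  have hS := h.le
  have h1 := C.apply_add h (Nat.sub_add_cancel hS)
  have h2 := C.cnt_apply_add h (Nat.sub_add_cancel hS)
  obtain ⟨R, rfl⟩ : ∃ R, m = R + S := ⟨m - S, by omega⟩
  obtain ⟨d, rfl⟩ : ∃ d, B = b + d := ⟨B - b, by omega⟩
  rw [h2, h1, cnt_decide_le, cnt_decide_le]
  simp only [Nat.add_sub_cancel, Nat.add_sub_cancel_left]
  constructor <;> ring

theorem cnt_pred (C : RunCoding y z f A b B) (hb : 0 < b) (hbB : b ≤ B) (j : ℕ) :
    cnt z (f (j + 1)) = cnt z (f (j + 1) - 1) + 1 := by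
  have h1 := C.apply_succ j
  have h4 : b ≤ if y j then B else b := by
    split <;> omega
  have h2 := C.cnt_offset (j := j) (t := f (j + 1) - f j) (by omega)
  have h3 := C.cnt_offset (j := j) (t := f (j + 1) - f j - 1) (by omega)
  rw [show f j + (f (j + 1) - f j) = f (j + 1) by omega] at h2
  rw [show f j + (f (j + 1) - f j - 1) = f (j + 1) - 1 by omega] at h3
  omega

theorem exists_eq_of_zeros (C : RunCoding y z f A b B) (hb : 0 < b) (hbB : b ≤ B) (hA : 0 < A)
    {x : ℕ} (hx : f 0 ≤ x) (h : ∀ t < A, z (x + t) = false) : ∃ j, x = f j := by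
  obtain ⟨j, hj, hj'⟩ := C.locate hx
  have h1 := C.apply_succ j
  have h4 : b ≤ if y j then B else b := by
    split <;> omega
  refine ⟨j, ?_⟩
  by_contra hne
  have h5 := C.letter (j := j) (t := x - f j) (by omega)
  rw [show f j + (x - f j) = x by omega] at h5
  have h6 := h 0 hA
  rw [add_zero, h5, decide_eq_false_iff_not] at h6
  have h7 := C.letter (j := j) (t := A) (by omega)
  have h8 := h (f j + A - x) (by omega)
  rw [show x + (f j + A - x) = f j + A by omega, h7] at h8
  simp at h8

theorem exists_eq_of_run (C : RunCoding y z f A b B) (hz : Rec z) (hb : 0 < b) (hbB : b ≤ B)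
    {m : ℕ} (h : Run z true m) : ∃ j, m = if y j then B else b := by
  obtain ⟨hm, i, h1, h2, h3⟩ := h
  obtain ⟨x, hx, e⟩ := hz i (1 + m + 1) (f 0)
  obtain ⟨j, hj, hj'⟩ := C.locate hx
  refine ⟨j, ?_⟩
  have h4 := C.apply_succ j
  have h5 : b ≤ if y j then B else b := by
    split <;> omega
  have e0 := e 0 (by omega)
  have h6 := C.letter (j := j) (t := x - f j) (by omega)
  rw [show f j + (x - f j) = x + 0 by omega, e0, add_zero, h1] at h6
  have h6' : x < f j + A := by
    by_contra! hc
    rw [decide_eq_true (by omega)] at h6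
    simp at h6
  have h7 := C.letter (j := j) (t := x + 1 - f j) (by omega)
  have e1 := e 1 (by omega)
  have h2' := h2 0 hm
  rw [add_zero] at h2'
  rw [show f j + (x + 1 - f j) = x + 1 by omega, e1, h2'] at h7
  have h7' := of_decide_eq_true h7.symm
  have hx' : x + 1 = f j + A := by omega
  have em := e (1 + m) (by omega)
  rw [← add_assoc, ← add_assoc, h3, hx'] at em
  have h9 : f (j + 1) ≤ f j + A + m := by
    by_contra! hc
    have h8 := C.letter (j := j) (t := A + m) (by omega)
    rw [← add_assoc, em] at h8
    simp at h8
  by_contra hne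
  have h10 := C.apply_succ (j + 1)
  have h11 := C.letter (j := j + 1) (t := 0) (by
    have := C.strictMono (Nat.lt_succ_self (j + 1))
    simpa using this)
  have h12 := h2 (f (j + 1) - (x + 1)) (by omega)
  have e2 := e (1 + (f (j + 1) - (x + 1))) (by omega)
  rw [← add_assoc, ← add_assoc, h12, show x + 1 + (f (j + 1) - (x + 1)) = f (j + 1) + 0 by omega,
    h11] at e2
  have := of_decide_eq_true e2
  omega

theorem recurrent (C : RunCoding y z f A b B) (hz : Rec z) (hb : 0 < b) (hbB : b ≤ B) (hA : 0 < A)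
    (he : ∀ j, y j = z (f j + (A + b))) : Rec y := by
  refine Coding.recurrent C hz he fun j => ⟨A, fun x hx h => ?_⟩
  refine C.exists_eq_of_zeros hb hbB hA hx fun t ht => ?_
  have h1 := C.apply_succ j
  rw [h t ht, C.letter (by omega)]
  simpa using ht

theorem heavy_window (C : RunCoding y z f A b B) (hb : 0 < b) (hbB : b < B) (hA : 2 ≤ A)
    {L p ε : ℕ} (hε : ε ≤ 1) (hS : ∀ j, cnt y (j + (L + 1)) ≤ cnt y j + p) {x : ℕ}
    (hx : f 0 ≤ x) :
    let W := (L + 1) * b + p * (B - b)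
    cnt z (x + (W + L * A + ε)) ≤ cnt z x + W ∧
    (Occ z (W + L * A + ε) W x →
      ∃ j, Occ y (L + 1) p j ∧ (x = f j + A ∨ ε = 1 ∧ x + 1 = f j + A)) := by
  intro W
  obtain ⟨j, hj, hj'⟩ := C.locate hx
  obtain ⟨S, hSj⟩ : ∃ S, Occ y (L + 1) S j :=
    ⟨cnt y (j + (L + 1)) - cnt y j, by
      have := cnt_le_add y j (L + 1)
      unfold Occ
      omega⟩
  have hSp : S ≤ p := by
    have := hS j
    unfold Occ at hSj
    omega
  obtain ⟨h1, h2⟩ := C.window hbB.le hSj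
  set V := (L + 1) * b + S * (B - b) with hV
  have h3 := C.cnt_offset (j := j) (t := x - f j) (by omega)
  rw [show f j + (x - f j) = x by omega] at h3
  have hVW : V ≤ W := Nat.add_le_add_left (Nat.mul_le_mul_right _ hSp) _
  have hVW' : S ≠ p → V < W := fun h =>
    Nat.add_lt_add_left (Nat.mul_lt_mul_of_pos_right (by omega) (by omega)) _
  rw [Nat.succ_mul] at h1
  suffices hh : cnt z (x + (W + L * A + ε)) < cnt z x + W ∨
      S = p ∧ cnt z (x + (W + L * A + ε)) ≤ cnt z x + W ∧
        (x = f j + A ∨ ε = 1 ∧ x + 1 = f j + A) by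
    rcases hh with hh | ⟨rfl, hh, hh'⟩
    · refine ⟨hh.le, fun ho => ?_⟩
      unfold Occ at ho
      omega
    · exact ⟨hh, fun _ => ⟨j, hSj, hh'⟩⟩
  generalize hN : x + (W + L * A + ε) = e
  rcases lt_or_ge e (f (j + (L + 1))) with he | he
  · left
    have h4 := C.cnt_pred hb hbB.le (j + L)
    have h5 := cnt_mono z (show e ≤ f (j + L + 1) - 1 by rw [add_assoc]; omega)
    rw [add_assoc] at h4 h5
    omega
  · have h4 := C.cnt_offset_le (j + (L + 1)) (e - f (j + (L + 1)))
    rw [show f (j + (L + 1)) + (e - f (j + (L + 1))) = e by omega] at h4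
    by_cases h6 : S = p
    · have : V = W := by rw [hV, h6]
      by_cases h7 : x ≤ f j + A
      · right
        refine ⟨h6, ?_, ?_⟩ <;> omega
      · left
        omega
    · have := hVW' h6
      left
      omega

theorem heavy_occ (C : RunCoding y z f A b B) (hbB : b < B) (hA : 2 ≤ A)
    {L p ε j : ℕ} (hε : ε ≤ 1) (h : Occ y (L + 1) p j) :
    let W := (L + 1) * b + p * (B - b)
    Occ z (W + L * A + ε) W (f j + A) ∧ (ε = 1 → Occ z (W + L * A + ε) W (f j + A - 1)) := by
  intro W
  obtain ⟨h1, h2⟩ := C.window hbB.le h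
  rw [Nat.succ_mul] at h1
  have h0 := C.apply_succ j
  have h3 := C.cnt_offset (j := j) (t := A) (by omega)
  have h4 := C.cnt_offset (j := j) (t := A - 1) (by omega)
  have h5 := C.apply_succ (j + (L + 1))
  have h6 := C.cnt_offset (j := j + (L + 1)) (t := ε) (by omega)
  constructor
  · unfold Occ
    rw [show f j + A + (W + L * A + ε) = f (j + (L + 1)) + ε by omega]
    omega
  · rintro rfl
    unfold Occ
    rw [show f j + A - 1 + (W + L * A + 1) = f (j + (L + 1)) by omega,
      show f j + A - 1 = f j + (A - 1) by omega]
    omega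

theorem light_window (C : RunCoding y z f A b B) (hb : 0 < b) (hbB : b < B) (hA : 0 < A) {x : ℕ}
    (hx : f 0 ≤ x) : cnt z x + b ≤ cnt z (x + (2 * A + b)) ∧
      (Occ z (2 * A + b) b x → ∃ j, y j = false ∧ x = f j) := by
  obtain ⟨j, hj, hj'⟩ := C.locate hx
  have h1 := C.apply_succ j
  have h3 := C.cnt_offset (j := j) (t := x - f j) (by omega)
  rw [show f j + (x - f j) = x by omega] at h3
  have h4 := C.cnt_offset (j := j) (t := f (j + 1) - f j) (by omega)
  rw [show f j + (f (j + 1) - f j) = f (j + 1) by omega] at h4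
  have h5 := C.le_cnt_offset hbB.le (j + 1) (x + (2 * A + b) - f (j + 1))
  suffices hh : cnt z x + b < cnt z (x + (2 * A + b)) ∨
      cnt z x + b ≤ cnt z (x + (2 * A + b)) ∧ y j = false ∧ x = f j by
    rcases hh with hh | ⟨hh, hh'⟩
    · refine ⟨hh.le, fun ho => ?_⟩
      unfold Occ at ho
      omega
    · exact ⟨hh, fun _ => ⟨j, hh'⟩⟩
  rcases le_or_gt (x + (2 * A + b)) (f (j + 1)) with he | he
  · have h6 := C.cnt_offset (j := j) (t := x + (2 * A + b) - f j) (by omega)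
    rw [show f j + (x + (2 * A + b) - f j) = x + (2 * A + b) by omega] at h6
    left
    omega
  · rw [show f (j + 1) + (x + (2 * A + b) - f (j + 1)) = x + (2 * A + b) by omega] at h5
    cases hy : y j <;> simp only [hy, if_true, if_false, Bool.false_eq_true] at h1
    · by_cases hxj : x = f j
      · right
        refine ⟨?_, rfl, hxj⟩
        omega
      · left
        omega
    · left
      omega

theorem light_occ (C : RunCoding y z f A b B) {j : ℕ} (hj : y j = false) :
    Occ z (2 * A + b) b (f j) := by
  have h1 := C.apply_succ j
  have h0 := C.apply_succ (j + 1)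
  simp only [hj, if_false, Bool.false_eq_true] at h1
  have h4 := C.cnt_offset (j := j) (t := A + b) (by omega)
  have h6 := C.cnt_offset (j := j + 1) (t := A) (by omega)
  rw [show f j + (A + b) = f (j + 1) by omega] at h4
  unfold Occ
  rw [show f j + (2 * A + b) = f (j + 1) + A by omega]
  omega

end RunCoding

theorem exists_gap {P : ℕ → Prop} {a b i n : ℕ} (ha : P a) (hai : a ≤ i) (hn : 0 < n)
    (h : ∀ t < n, ¬ P (i + t)) (hb : P b) (hib : i ≤ b) :
    ∃ j j', P j ∧ P j' ∧ j + n < j' ∧ ∀ k, j < k → k < j' → ¬ P k := by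
  classical
  have hex : ∃ b, i ≤ b ∧ P b := ⟨b, hib, hb⟩
  have h1 := Nat.findGreatest_spec (P := P) hai ha
  have h2 := Nat.findGreatest_le (P := P) i
  have h3 : Nat.findGreatest P i ≠ i := fun e => h 0 hn (by rwa [e] at h1)
  obtain ⟨h4, h5⟩ := Nat.find_spec hex
  refine ⟨_, _, h1, h5, ?_, ?_⟩
  · by_contra! hc
    have := h (Nat.find hex - i) (by omega)
    rw [Nat.add_sub_cancel' h4] at this
    exact this h5
  · intro k hk hk' hP
    rcases le_total k i with hki | hki
    · exact Nat.findGreatest_is_greatest hk hki hP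
    · exact Nat.find_min hex hk' ⟨hki, hP⟩

namespace RunCoding

variable {y z : ℕ → Bool} {f : ℕ → ℕ} {A b B : ℕ}

theorem bad_of_unbounded (C : RunCoding y z f A b B) (hz : Rec z) (hy : Rec y) (hb : 0 < b)
    (hbB : b < B) (hA : 0 < A) (h0 : ∃ j, y j = false)
    (h : ∀ n, ∃ i, ∀ t < n, y (i + t) = true) : Bad z := by
  obtain ⟨a, ha⟩ := h0
  refine ⟨2 * A + b, b, by omega, Or.inl (hz.ge_of_ge fun x hx => (C.light_window hb hbB hA hx).1),
    Or.inl (four_of_unbounded fun n => ?_)⟩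
  obtain ⟨i₀, hi₀⟩ := h (n + 1)
  obtain ⟨i, hi, e⟩ := hy i₀ (n + 1) a
  obtain ⟨d, hd, hd'⟩ := hy.exists_eq a i
  obtain ⟨j, j', h1, h2, h3, h4⟩ := exists_gap (P := fun j => y j = false) ha hi n.succ_pos
    (fun t ht => by simp [e t ht, hi₀ t ht]) (by rw [hd', ha]) hd
  have h5 : Cons z (2 * A + b) b (f j + 0) (f j' + 0) := by
    refine C.cons (P := fun j => y j = false) (fun x hx => ?_) h1 h2 (by omega) h4
    refine ⟨(C.light_window hb hbB hA hx).2, ?_⟩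
    rintro ⟨k, hk, rfl⟩
    exact C.light_occ hk
  have h6 := C.strictMono.add_le_nat (j' - j) j
  rw [Nat.sub_add_cancel (by omega)] at h6
  refine ⟨_, cnt z (f j') - cnt z (f j), ?_, Ret.of_cons h5 ?_⟩
  · omega
  · have := cnt_mono z (show f j ≤ f j' by omega)
    simp only [add_zero]
    omega

theorem bad_of_bounded (C : RunCoding y z f A b B) (hz : Rec z) (hy : Rec y) (hb : 0 < b)
    (hbB : b < B) (hA : 2 ≤ A) {p : ℕ} (hp : 0 < p) (h1 : ∃ i, ∀ t < p, y (i + t) = true)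
    (h2 : ¬ ∃ i, ∀ t < p + 1, y (i + t) = true) : Bad z := by
  obtain ⟨d, hd⟩ : ∃ d, B - b = d + 1 := ⟨B - b - 1, by omega⟩
  have hlong : ∃ m i, cnt y i + p + 1 ≤ cnt y (i + m) := by
    have key : ∀ q, ∃ n, q ≤ cnt y n := by
      intro q
      induction q with
      | zero => exact ⟨0, Nat.zero_le _⟩
      | succ q ih =>
        obtain ⟨n, hn⟩ := ih
        obtain ⟨i, hi⟩ := h1
        obtain ⟨j, hj, e⟩ := hy.exists_eq i n
        have h3 := cnt_succ_true (e.trans (hi 0 hp))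
        have := cnt_mono y hj
        exact ⟨j + 1, by omega⟩
    obtain ⟨n, hn⟩ := key (p + 1)
    exact ⟨n, 0, by simp [cnt]; omega⟩
  classical
  obtain ⟨M, hM, hmin⟩ : ∃ M, (∃ i, cnt y i + p + 1 ≤ cnt y (i + M)) ∧
      ∀ m < M, ∀ i, cnt y (i + m) ≤ cnt y i + p :=
    ⟨Nat.find hlong, Nat.find_spec hlong, fun m hm i => by
      have := Nat.find_min hlong hm
      push Not at this
      have := this i
      omega⟩
  have hMp : p + 2 ≤ M := by
    obtain ⟨i, hi⟩ := hM
    have h3 := cnt_add_le y i M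
    by_contra! hc
    obtain rfl : M = p + 1 := by omega
    exact h2 ⟨i, occ_full.1 (by unfold Occ; omega)⟩
  obtain ⟨L, rfl⟩ : ∃ L, M = L + 1 + 1 := ⟨M - 2, by omega⟩
  have hS : ∀ j, cnt y (j + (L + 1)) ≤ cnt y j + p := hmin (L + 1) (by omega)
  have hS' : ∀ j, cnt y (j + L) ≤ cnt y j + p := hmin L (by omega)
  -- the flat return with the letter `true`
  obtain ⟨i₁, ho₁, ho₁', hi₁⟩ : ∃ i, Occ y (L + 1) p i ∧ Occ y (L + 1) p (i + 1) ∧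
      y i = true := by
    obtain ⟨i, hi⟩ := hM
    have h3 := hS i
    have h4 := hS (i + 1)
    have h5 := cnt_succ y i
    have h6 := cnt_succ y (i + (L + 1))
    have h7 := Bool.toNat_le (y (i + (L + 1)))
    rw [add_assoc i (L + 1) 1] at h6
    rw [show i + 1 + (L + 1) = i + (L + 1 + 1) by omega] at h4
    have h8 : y i = true := by
      cases h : y i
      · rw [h] at h5
        simp at h5
        omega
      · rfl
    have h9 := cnt_succ_true h8
    refine ⟨i, ?_, ?_, h8⟩
    · unfold Occ
      omega
    · unfold Occ
      rw [show i + 1 + (L + 1) = i + (L + 1 + 1) by omega]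
      omega
  -- the flat return with the letter `false`
  obtain ⟨i₀, ho₀, ho₀', hi₀⟩ : ∃ i, Occ y (L + 1) p i ∧ Occ y (L + 1) p (i + 1) ∧
      y i = false := by
    obtain ⟨a, ha⟩ := h1
    obtain ⟨i', hi', e⟩ := hy a p 1
    obtain ⟨i, rfl⟩ : ∃ i, i' = i + 1 := ⟨i' - 1, by omega⟩
    have h3 : cnt y (i + 1 + p) = cnt y (i + 1) + p :=
      cnt_add_true fun t ht => by rw [e t ht, ha t ht]
    have h8 : y i = false := by
      by_contra hc
      rw [Bool.not_eq_false] at hc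
      refine h2 ⟨i, fun t ht => ?_⟩
      cases t with
      | zero => exact hc
      | succ t => rw [show i + (t + 1) = i + 1 + t by omega, e t (by omega), ha t (by omega)]
    have h4 := cnt_succ_false h8
    have h5 := hS i
    have h6 := hS (i + 1)
    have h7 := cnt_mono y (show i + 1 + p ≤ i + (L + 1) by omega)
    have h9 := cnt_mono y (show i + 1 + p ≤ i + 1 + (L + 1) by omega)
    refine ⟨i, ?_, ?_, h8⟩ <;> unfold Occ <;> omega
  by_cases hgap : ∃ i j, Cons y (L + 1) p i j ∧ i + 1 < j
  · obtain ⟨i₂, j₂, hc₂, hij⟩ := hgap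
    set W := (L + 1) * b + p * (B - b) with hW
    have hO : ∀ x, f 0 ≤ x → (Occ z (W + L * A + 1) W x ↔
        ∃ j, Occ y (L + 1) p j ∧ (x = f j + A ∨ x + 1 = f j + A)) := by
      intro x hx
      constructor
      · intro ho
        obtain ⟨j, hj, hj'⟩ := (C.heavy_window hb hbB hA le_rfl hS hx).2 ho
        exact ⟨j, hj, hj'.imp id And.right⟩
      · rintro ⟨j, hj, rfl | hx'⟩
        · exact (C.heavy_occ hbB hA le_rfl hj).1
        · have := (C.heavy_occ hbB hA le_rfl hj).2 rfl
          rwa [show f j + A - 1 = x by omega] at this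
    have hret : ∀ i j, Cons y (L + 1) p i j → ∀ S, Occ y (j - i) S i →
        Ret z (W + L * A + 1) W ((j - i) * A + ((j - i) * b + S * (B - b)) - 1)
          ((j - i) * b + S * (B - b)) := by
      intro i j hc S hSo
      have hij := hc.2.2.1
      obtain ⟨h3, h4⟩ := C.window hbB.le hSo
      rw [Nat.add_sub_cancel' hij.le] at h3 h4
      set V := (j - i) * b + S * (B - b)
      have h5 := C.apply_succ i
      have h6 := C.apply_succ j
      have h7 := C.cnt_offset (j := i) (t := A) (by omega)
      have h8 := C.cnt_offset (j := j) (t := A - 1) (by omega)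
      have h9 := C.strictMono.monotone (show i + 1 ≤ j from hij)
      have h10 := C.strictMono.monotone (Nat.zero_le i)
      have key : Cons z (W + L * A + 1) W (f i + A) (f j + (A - 1)) := by
        refine ⟨(hO _ (by omega)).2 ⟨i, hc.1, Or.inl rfl⟩,
          (hO _ (by omega)).2 ⟨j, hc.2.1, Or.inr (by omega)⟩, by omega, ?_⟩
        intro x hx hx' hox
        obtain ⟨k, hk, hk'⟩ := (hO x (by omega)).1 hox
        have hik : i < k := by
          by_contra! hki
          have := C.strictMono.monotone hki
          omega
        have hkj : k < j := by
          by_contra! hki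
          have := C.strictMono.monotone hki
          omega
        exact hc.2.2.2 k hik hkj hk
      have := Ret.of_cons (k := V) key (by omega)
      rwa [show f j + (A - 1) - (f i + A) = (j - i) * A + V - 1 by omega] at this
    have hr₀ := hret i₀ (i₀ + 1) (cons_succ ho₀ ho₀') 0 (by
      rw [Nat.add_sub_cancel_left]
      exact cnt_succ_false hi₀)
    have hr₁ := hret i₁ (i₁ + 1) (cons_succ ho₁ ho₁') 1 (by
      rw [Nat.add_sub_cancel_left]
      exact cnt_succ_true hi₁)
    have hr₂ := hret i₂ j₂ hc₂ (cnt y j₂ - cnt y i₂) (by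
      unfold Occ
      rw [Nat.add_sub_cancel' hc₂.2.2.1.le]
      have := cnt_mono y hc₂.2.2.1.le
      omega)
    rw [Nat.add_sub_cancel_left, one_mul, one_mul] at hr₀ hr₁
    have hr₃ : Ret z (W + L * A + 1) W 1 0 := by
      have h3 := (hO (f i₀ + (A - 1)) (by
        have := C.strictMono.monotone (Nat.zero_le i₀)
        omega)).2 ⟨i₀, ho₀, Or.inr (by omega)⟩
      have h4 := (hO (f i₀ + (A - 1) + 1) (by
        have := C.strictMono.monotone (Nat.zero_le i₀)
        omega)).2 ⟨i₀, ho₀, Or.inl (by omega)⟩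
      refine ret_one_of_false h3 h4 ?_
      have := C.apply_succ i₀
      rw [C.letter (by omega)]
      simp
      omega
    have hlen : 2 * A ≤ (j₂ - i₂) * A := Nat.mul_le_mul_right A (by omega)
    refine ⟨_, W, ?_, Or.inr (hz.le_of_ge fun x hx => (C.heavy_window hb hbB hA le_rfl hS hx).1),
      Or.inl (Four.mk hr₃ hr₀ hr₁ hr₂ ?_ ?_ ?_ ?_ ?_ ?_)⟩
    · omega
    all_goals
      generalize (j₂ - i₂) * b + (cnt y j₂ - cnt y i₂) * (B - b) = V at *
      generalize (j₂ - i₂) * A = U at *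
      omega
  · push Not at hgap
    have hall : ∀ m, Occ y (L + 1) p (i₁ + m) := by
      intro m
      induction m with
      | zero => exact ho₁
      | succ m ih =>
        obtain ⟨j, hj, hj'⟩ := hy.exists_occ ih (i₁ + m + 1)
        classical
        have hex : ∃ j, i₁ + m < j ∧ Occ y (L + 1) p j := ⟨j, hj, hj'⟩
        obtain ⟨h3, h4⟩ := Nat.find_spec hex
        have := hgap _ _ ⟨ih, h4, h3, fun k hk hk' ho => Nat.find_min hex hk' ⟨hk, ho⟩⟩
        rw [show i₁ + (m + 1) = Nat.find hex by omega]
        exact h4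
    have hper : ∀ j, i₁ ≤ j → y (j + (L + 1)) = y j := by
      intro j hj
      have h3 := hall (j - i₁)
      have h4 := hall (j + 1 - i₁)
      rw [show i₁ + (j - i₁) = j by omega] at h3
      rw [show i₁ + (j + 1 - i₁) = j + 1 by omega] at h4
      unfold Occ at h3 h4
      rw [show j + 1 + (L + 1) = j + (L + 1) + 1 by omega, cnt_succ, cnt_succ] at h4
      cases h5 : y j <;> cases h6 : y (j + (L + 1)) <;> simp [h5, h6] at h4 ⊢ <;> omega
    obtain ⟨q, rfl⟩ : ∃ q, p = q + 1 := ⟨p - 1, by omega⟩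
    have hq : ∀ j, cnt y (j + (q + 1)) ≤ cnt y j + (q + 1) := fun j => cnt_add_le y j (q + 1)
    have hw := fun {x : ℕ} (hx : f 0 ≤ x) =>
      C.heavy_window hb hbB hA (ε := 0) (Nat.zero_le 1) hq hx
    refine ⟨(q + 1) * b + (q + 1) * (B - b) + q * A + 0, _, ?_,
      Or.inr (hz.le_of_ge fun x hx => (hw hx).1), Or.inr ?_⟩
    · have := Nat.mul_pos q.succ_pos hb
      simp only [Nat.succ_eq_add_one] at this
      omega
    refine C.single (P := fun j => Occ y (q + 1) (q + 1) j) (s := A) (M := f 0) (N := i₁)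
      L.succ_pos hper ?_ ?_ ?_
    · intro i j hi hij hi' hj'
      by_contra! hc
      have hi2 := occ_full.1 hi'
      have hj2 := occ_full.1 hj'
      rcases lt_or_ge j (i + (q + 1)) with hlt | hge
      · refine h2 ⟨i, fun t ht => ?_⟩
        rcases Nat.lt_or_ge t (q + 1) with ht' | ht'
        · exact hi2 t ht'
        · have := hj2 (i + t - j) (by omega)
          rwa [Nat.add_sub_cancel' (by omega)] at this
      · have h3 := hS i
        have h4 := cnt_succ_true (hj2 0 (by omega))
        have h5 := cnt_mono y hge
        have h6 := cnt_mono y (show j + 1 ≤ i + (L + 1) by simp at hc; omega)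
        unfold Occ at hi'
        rw [add_zero] at h4
        omega
    · obtain ⟨a, ha⟩ := h1
      exact ⟨_, (C.heavy_occ hbB hA (Nat.zero_le 1) (occ_full.2 ha)).1⟩
    · intro x hx ho
      obtain ⟨j, hj, hj'⟩ := (hw hx).2 ho
      exact ⟨j, hj, hj'.resolve_right (by simp)⟩

end RunCoding

/-- A recurrent word all of whose maximal runs of `false` have the same length `A ≥ 2`. -/
theorem bad_of_single_run {z : ℕ → Bool} (hz : Rec z) {A : ℕ} (hA : 2 ≤ A)
    (hA0 : Run z false A) (hA1 : ∀ k, Run z false k → k = A) : Bad z := by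
  obtain ⟨a, b, ha, hb⟩ : ∃ a b, z a = true ∧ z b = false := by
    obtain ⟨-, i, h1, h2, -⟩ := hA0
    exact ⟨i, i + 1 + 0, h1, h2 0 (by omega)⟩
  obtain ⟨i, -, hi, hi'⟩ := hz.exists_boundary (x := false) ha hb 0
  obtain ⟨m, hm⟩ := hz.exists_run (x := true) hb ha
  by_cases hex : ∃ m', Run z true m' ∧ m' ≠ m
  · obtain ⟨m', hm', hne⟩ := hex
    by_cases hex3 : ∃ m₃, Run z true m₃ ∧ m₃ ≠ m ∧ m₃ ≠ m'
    · obtain ⟨m₃, hm₃, hne1, hne2⟩ := hex3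
      have h2 : Ret z 1 0 1 0 := by
        obtain ⟨-, j, -, h2, -⟩ := hA0
        exact ret_one_of_false (occ_one_zero.2 (h2 0 (by omega)))
          (occ_one_zero.2 (h2 1 (by omega))) (h2 0 (by omega))
      have := hm.1
      have := hm'.1
      have := hm₃.1
      refine ⟨1, 0, one_pos, Or.inl fun i => cnt_le_add z i 1,
        Or.inl (Four.mk h2 (ret_one_zero_of_run hm) (ret_one_zero_of_run hm')
          (ret_one_zero_of_run hm₃) ?_ ?_ ?_ ?_ ?_ ?_)⟩ <;> omega
    · push Not at hex3
      obtain ⟨b, B, hbB, hb, hB, hall⟩ : ∃ b B, b < B ∧ Run z true b ∧ Run z true B ∧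
          ∀ k, Run z true k → k = b ∨ k = B := by
        rcases lt_or_gt_of_ne hne with hlt | hlt
        · exact ⟨m', m, hlt, hm', hm, fun k hk => by have := hex3 k hk; tauto⟩
        · exact ⟨m, m', hlt, hm, hm', fun k hk => by have := hex3 k hk; tauto⟩
      obtain ⟨y, f, C, he⟩ := exists_runCoding hz (by omega) hb.1 hbB.le hA1 hall hi hi'
      have hy := C.recurrent hz hb.1 hbB.le (by omega) he
      have h0 : ∃ j, y j = false := by
        obtain ⟨j, hj⟩ := C.exists_eq_of_run hz hb.1 hbB.le hb
        refine ⟨j, ?_⟩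
        cases h : y j
        · rfl
        · simp [h] at hj
          omega
      have h1 : ∃ j, y j = true := by
        obtain ⟨j, hj⟩ := C.exists_eq_of_run hz hb.1 hbB.le hB
        refine ⟨j, ?_⟩
        cases h : y j
        · simp [h] at hj
          omega
        · rfl
      by_cases hun : ∀ n, ∃ i, ∀ t < n, y (i + t) = true
      · exact C.bad_of_unbounded hz hy hb.1 hbB (by omega) h0 hun
      · push Not at hun
        classical
        have hmin := fun m hm => Nat.find_min hun (m := m) hm
        have hspec := Nat.find_spec hun
        set n := Nat.find hun
        have hn : 2 ≤ n := by
          by_contra! hc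
          obtain ⟨j, hj⟩ := h1
          obtain ⟨t, ht, hne⟩ := hspec j
          obtain rfl : t = 0 := by omega
          exact hne hj
        have h4 := hmin (n - 1) (by omega)
        refine C.bad_of_bounded hz hy hb.1 hbB hA (p := n - 1) (by omega) ?_ ?_
        · push Not at h4
          exact h4
        · rw [Nat.sub_add_cancel (by omega)]
          push Not
          exact hspec
  · push Not at hex
    have hm0 := hm.1
    obtain ⟨y, f, C, he⟩ := exists_runCoding hz (by omega) hm0 le_rfl hA1
      (fun k hk => Or.inl (hex k hk)) hi hi'
    have hy : ∀ j, y j = false := by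
      intro j
      have h1 := C.apply_succ j
      have h2 := C.apply_succ (j + 1)
      simp only [ite_self] at h1 h2
      have h3 := C.letter (j := j + 1) (t := 0) (by omega)
      rw [he, show f j + (A + m) = f (j + 1) + 0 by omega, h3]
      simp
      omega
    refine ⟨A, 0, by omega, Or.inl fun i => cnt_le_add z i A, Or.inr ?_⟩
    refine C.single (P := fun _ => True) (d := 1) (N := 0) (s := 0) (M := f 0) one_pos
      (fun j _ => by rw [hy, hy]) (fun i j _ h _ _ => h) ?_ ?_
    · obtain ⟨-, j, -, h2, -⟩ := hA0
      exact ⟨_, occ_zero.2 h2⟩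
    · intro x hx ho
      obtain ⟨j, rfl⟩ := C.exists_eq_of_zeros hm0 le_rfl (by omega) hx (occ_zero.1 ho)
      exact ⟨j, trivial, rfl⟩

theorem run_swapLetters {w : ℕ → Bool} {x : Bool} {k : ℕ} :
    Run (swapLetters w) x k ↔ Run w (!x) k := by
  simp only [Run, swapLetters, Bool.not_not]
  refine and_congr_right fun _ => exists_congr fun i => ?_
  cases x <;> simp

theorem occ_two_one {w : ℕ → Bool} {i : ℕ} : Occ w 2 1 i ↔ w i ≠ w (i + 1) := by
  unfold Occ
  rw [show i + 2 = i + 1 + 1 from rfl, cnt_succ, cnt_succ]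
  cases w i <;> cases w (i + 1) <;> simp

theorem ret_two_one_of_run_false {w : ℕ → Bool} {k : ℕ} (h : Run w false k) : Ret w 2 1 k 1 := by
  obtain ⟨hk, i, h1, h2, h3⟩ := h
  have h4 : cnt w (i + 1 + (k - 1)) = cnt w (i + 1) := cnt_add_false fun t ht => h2 t (by omega)
  have h5 := cnt_succ_true h1
  have h6 : w (i + k) = false := by
    rw [← h2 (k - 1) (by omega)]
    congr 1
    omega
  refine ⟨i, ⟨occ_two_one.2 ?_, occ_two_one.2 ?_, by omega, ?_⟩, ?_⟩
  · have := h2 0 hk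
    rw [add_zero] at this
    rw [h1, this]
    simp
  · rw [h6, show i + k + 1 = i + 1 + k by omega, h3]
    simp
  · intro m hm hm' ho
    rw [occ_two_one] at ho
    have h7 := h2 (m - (i + 1)) (by omega)
    have h8 := h2 (m + 1 - (i + 1)) (by omega)
    rw [Nat.add_sub_cancel' (by omega)] at h7 h8
    exact ho (h7.trans h8.symm)
  · rw [show i + k = i + 1 + (k - 1) by omega]
    omega

theorem ret_two_one_of_run_true {w : ℕ → Bool} {k : ℕ} (h : Run w true k) :
    Ret w 2 1 k (k - 1) :=
  (ret_two_one_of_run_false (run_swapLetters.2 h)).of_swapLetters (c := 1) rfl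

/-- `w` is the image of `z`, from position `f 0` on, under `0 ↦ 0`, `1 ↦ 01`. -/
abbrev IsolatedCoding (z w : ℕ → Bool) (f : ℕ → ℕ) : Prop :=
  Coding z w f 1 2 (fun _ => false) (fun t => decide (t = 1))

/-- Positions of the letters `false` in a word without two consecutive letters `true`. -/
def zeroPos (w : ℕ → Bool) : ℕ → ℕ
  | 0 => if w 0 then 1 else 0
  | j + 1 => zeroPos w j + if w (zeroPos w j + 1) then 2 else 1

theorem exists_isolatedCoding {w : ℕ → Bool} (h : ∀ i, w i = true → w (i + 1) = false) :
    ∃ z f, IsolatedCoding z w f ∧ ∀ j, z j = w (f j + 1) := by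
  have hs : ∀ j, zeroPos w (j + 1) = zeroPos w j + if w (zeroPos w j + 1) then 2 else 1 :=
    fun j => rfl
  have h0 : ∀ j, w (zeroPos w j) = false := by
    intro j
    induction j with
    | zero =>
      unfold zeroPos
      split
      · exact h 0 ‹_›
      · simpa using ‹¬ w 0 = true›
    | succ j ih =>
      rw [hs]
      split
      · exact h _ ‹_›
      · simpa using ‹¬ w (zeroPos w j + 1) = true›
  refine ⟨fun j => w (zeroPos w j + 1), zeroPos w,
    ⟨one_pos, two_pos, ?_, ?_, ?_, ?_⟩, fun j => rfl⟩
  · intro j hj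
    rw [hs, hj]
    rfl
  · intro j hj
    rw [hs, hj]
    rfl
  · intro j t _ ht
    obtain rfl : t = 0 := by omega
    exact h0 j
  · intro j t hj ht
    obtain rfl | rfl : t = 0 ∨ t = 1 := by omega
    · exact h0 j
    · exact hj

namespace IsolatedCoding

variable {z w : ℕ → Bool} {f : ℕ → ℕ}

theorem apply_succ (C : IsolatedCoding z w f) (j : ℕ) : f (j + 1) = f j + 1 + (z j).toNat := by
  cases h : z j
  · simp [C.step₀ h]
  · simp [C.step₁ h]

theorem apply_eq_false (C : IsolatedCoding z w f) (j : ℕ) : w (f j) = false := by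
  cases h : z j
  · exact C.letter₀ (t := 0) h (by omega)
  · exact C.letter₁ (t := 0) h (by omega)

theorem window (C : IsolatedCoding z w f) {j m S : ℕ} (h : Occ z m S j) :
    f (j + m) = f j + m + S ∧ cnt w (f (j + m)) = cnt w (f j) + S := by
  have hS := h.le
  have h1 := C.apply_add h (Nat.sub_add_cancel hS)
  have h2 := C.cnt_apply_add h (Nat.sub_add_cancel hS)
  rw [show cnt (fun _ => false) 1 = 0 from rfl, show cnt (fun t => decide (t = 1)) 2 = 1 from rfl]
    at h2
  omega

theorem window' (C : IsolatedCoding z w f) (j m : ℕ) :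
    f (j + m) + cnt z j = f j + m + cnt z (j + m) ∧
      cnt w (f (j + m)) + cnt z j = cnt w (f j) + cnt z (j + m) := by
  have h := cnt_le_add z j m
  have := C.window (j := j) (m := m) (S := cnt z (j + m) - cnt z j) (by unfold Occ; omega)
  omega

theorem cnt_offset_le (C : IsolatedCoding z w f) (j t : ℕ) :
    cnt w (f j + t) ≤ cnt w (f j) + (t - 1) := by
  cases t with
  | zero => simp
  | succ t =>
    have h1 := cnt_succ_false (C.apply_eq_false j)
    have h2 := cnt_add_le w (f j + 1) t
    rw [show f j + (t + 1) = f j + 1 + t by omega]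
    omega

theorem eq_or (C : IsolatedCoding z w f) {x : ℕ} (hx : f 0 ≤ x) :
    (∃ j, x = f j) ∨ ∃ j, z j = true ∧ x = f j + 1 := by
  obtain ⟨j, h1, h2⟩ := C.locate hx
  rw [C.apply_succ] at h2
  cases hz : z j <;> simp only [hz, Bool.toNat_false, Bool.toNat_true] at h2
  · exact Or.inl ⟨j, by omega⟩
  · obtain h3 | h3 : x = f j ∨ x = f j + 1 := by omega
    · exact Or.inl ⟨j, h3⟩
    · exact Or.inr ⟨j, hz, h3⟩

theorem recurrent (C : IsolatedCoding z w f) (hw : Rec w) (he : ∀ j, z j = w (f j + 1)) :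
    Rec z := by
  refine Coding.recurrent C hw he fun j => ⟨1, fun x hx h => ?_⟩
  obtain h1 | ⟨i, hi, rfl⟩ := C.eq_or hx
  · exact h1
  · have := h 0 one_pos
    rw [add_zero, add_zero, C.apply_eq_false, ← he, hi] at this
    simp at this

theorem light (C : IsolatedCoding z w f) {L c : ℕ} (hc : ∀ i, cnt z i + c ≤ cnt z (i + L))
    {x : ℕ} (hx : f 0 ≤ x) : cnt w x + c ≤ cnt w (x + (L + c + 1)) ∧
      (Occ w (L + c + 1) c x ↔ ∃ j, Occ z L c j ∧ x = f j + 0) := by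
  obtain ⟨j, rfl⟩ | ⟨j, hj, rfl⟩ := C.eq_or hx
  · have h1 := C.window' j L
    have h2 := hc j
    have h4 : ∀ u, f j + (L + c + 1) = f (j + L) + u → u ≤ 1 →
        cnt w (f j + (L + c + 1)) ≤ cnt w (f (j + L)) := by
      intro u hu hu'
      have := C.cnt_offset_le (j + L) u
      rw [hu]
      omega
    have h5 : ∀ u, f j + (L + c + 1) + u = f (j + L) →
        cnt w (f (j + L)) ≤ cnt w (f j + (L + c + 1)) + u := by
      intro u hu
      rw [← hu]
      exact cnt_add_le w _ u
    have h6 : f (j + L) ≤ f j + (L + c + 1) → cnt w (f (j + L)) ≤ cnt w (f j + (L + c + 1)) :=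
      fun h => cnt_mono w h
    have h7 := h4 1
    have h8 := h5 (f (j + L) - (f j + (L + c + 1)))
    refine ⟨by omega, fun ho => ⟨j, ?_, rfl⟩, ?_⟩
    · unfold Occ at *
      omega
    · rintro ⟨k, hk, hk'⟩
      obtain rfl := C.strictMono.injective (show f j = f k from hk')
      unfold Occ at *
      omega
  · have h0 := C.step₁ hj
    have h1 := C.window' (j + 1) L
    have h2 := hc (j + 1)
    have h3 := C.cnt_offset₁ (t := 2) hj le_rfl
    have h3' := C.cnt_offset₁ (t := 1) hj (by omega)
    rw [show cnt (fun t => decide (t = 1)) 2 = 1 from rfl, ← h0] at h3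
    rw [show cnt (fun t => decide (t = 1)) 1 = 0 from rfl] at h3'
    have h5 : f (j + 1) + (L + c) ≤ f (j + 1 + L) →
        cnt w (f (j + 1 + L)) ≤ cnt w (f j + 1 + (L + c + 1)) +
          (f (j + 1 + L) - (f (j + 1) + (L + c))) := by
      intro hu
      have := cnt_add_le w (f j + 1 + (L + c + 1)) (f (j + 1 + L) - (f (j + 1) + (L + c)))
      rwa [show f j + 1 + (L + c + 1) + (f (j + 1 + L) - (f (j + 1) + (L + c))) = f (j + 1 + L)
        by omega] at this
    refine ⟨by omega, fun ho => ?_, ?_⟩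
    · unfold Occ at ho
      omega
    · rintro ⟨k, -, hk'⟩
      have := C.strictMono.lt_iff_lt (a := j) (b := k)
      have := C.strictMono.le_iff_le (a := j + 1) (b := k)
      omega

theorem heavy (C : IsolatedCoding z w f) {L c : ℕ} (hL : 0 < L)
    (hc : ∀ i, cnt z (i + L) ≤ cnt z i + c) (hc0 : 0 < c)
    {x : ℕ} (hx : f 0 + 1 ≤ x) : cnt w (x + (L + c - 1)) ≤ cnt w x + c ∧
      (Occ w (L + c - 1) c x ↔ ∃ j, Occ z L c j ∧ x = f j + 1) := by
  obtain ⟨y, rfl⟩ : ∃ y, x = y + 1 := ⟨x - 1, by omega⟩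
  rw [show y + 1 + (L + c - 1) = y + (L + c) by omega]
  obtain ⟨j, rfl⟩ | ⟨j, hj, rfl⟩ := C.eq_or (x := y) (by omega)
  · have h1 := C.window' j L
    have h2 := hc j
    have h3 := cnt_succ_false (C.apply_eq_false j)
    have h4 := C.cnt_offset_le (j + L) (f j + (L + c) - f (j + L))
    rw [show f (j + L) + (f j + (L + c) - f (j + L)) = f j + (L + c) by omega] at h4
    have h5 : f j + (L + c) = f (j + L) → cnt w (f j + (L + c)) = cnt w (f (j + L)) :=
      fun h => by rw [h]
    refine ⟨by omega, fun ho => ⟨j, ?_, rfl⟩, ?_⟩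
    · unfold Occ at *
      rw [show f j + 1 + (L + c - 1) = f j + (L + c) by omega] at ho
      omega
    · rintro ⟨k, hk, hk'⟩
      obtain rfl := C.strictMono.injective (show f j = f k by omega)
      unfold Occ at *
      rw [show f j + 1 + (L + c - 1) = f j + (L + c) by omega]
      omega
  · have h0 := C.step₁ hj
    have h1 := C.window' j L
    have h2 := hc j
    have h3 := C.cnt_offset₁ (t := 2) hj le_rfl
    rw [show cnt (fun t => decide (t = 1)) 2 = 1 from rfl] at h3
    have h4 := C.cnt_offset_le (j + L) (f j + 1 + (L + c) - f (j + L))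
    rw [show f (j + L) + (f j + 1 + (L + c) - f (j + L)) = f j + 1 + (L + c) by omega] at h4
    rw [show f j + 1 + 1 = f j + 2 from rfl]
    refine ⟨by omega, fun ho => ?_, ?_⟩
    · unfold Occ at ho
      rw [show f j + 2 + (L + c - 1) = f j + 1 + (L + c) by omega] at ho
      omega
    · rintro ⟨k, -, hk'⟩
      have := C.strictMono.lt_iff_lt (a := j) (b := k)
      have := C.strictMono.le_iff_le (a := j + 1) (b := k)
      omega

theorem transfer (C : IsolatedCoding z w f) {L c N s : ℕ} (hs : s ≤ 1)
    (hO : ∀ x, f 0 + s ≤ x → (Occ w N c x ↔ ∃ j, Occ z L c j ∧ x = f j + s))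
    (h : Four z L c ∨ Single z L c) : Four w N c ∨ Single w N c := by
  refine h.imp (fun h => ?_) fun h => ?_
  · refine h.map (fun l k => (l + k, k)) (fun l k hr => ?_) ?_
    · obtain ⟨i, hi, hk⟩ := hr
      have h1 := C.cons hO hi.1 hi.2.1 hi.2.2.1 hi.2.2.2
      obtain ⟨h2, h3⟩ := C.window (S := k) hk
      have h4 : ∀ j, cnt w (f j + s) = cnt w (f j) := by
        intro j
        obtain rfl | rfl : s = 0 ∨ s = 1 := by omega
        · rfl
        · exact cnt_succ_false (C.apply_eq_false j)
      have := Ret.of_cons (k := k) h1 (by rw [h4, h4, h3])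
      rwa [show f (i + l) + s - (f i + s) = l + k by omega] at this
    · intro l k l' k' _ _ e
      simp only [Prod.mk.injEq] at e
      omega
  · obtain ⟨⟨i, hi⟩, M, d, hd, hp, hsp⟩ := h
    refine C.single hd hp hsp ⟨f i + s, (hO _ ?_).2 ⟨i, hi, rfl⟩⟩ fun x hx => (hO x hx).1
    have := C.strictMono.monotone (Nat.zero_le i)
    omega

theorem bad (C : IsolatedCoding z w f) (hw : Rec w) (h1 : ∃ a, z a = true) (h : Bad z) :
    Bad w := by
  obtain ⟨L, c, hL, hc | hc, hb⟩ := h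
  · exact ⟨L + c + 1, c, by omega, Or.inl (hw.ge_of_ge fun x hx => (C.light hc hx).1),
      C.transfer (Nat.zero_le 1) (fun x hx => (C.light hc hx).2) hb⟩
  · have hc0 : 0 < c := by
      obtain ⟨a, ha⟩ := h1
      have := cnt_succ_true ha
      have := cnt_mono z (show a + 1 ≤ a + L by omega)
      have := hc a
      omega
    exact ⟨L + c - 1, c, by omega, Or.inr (hw.le_of_ge fun x hx => (C.heavy hL hc hc0 hx).1),
      C.transfer le_rfl (fun x hx => (C.heavy hL hc hc0 hx).2) hb⟩

theorem unbalanced (C : IsolatedCoding z w f) (hw : Rec w) {n i j : ℕ}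
    (h : cnt w (j + n) + cnt w i + 2 ≤ cnt w (i + n) + cnt w j) :
    ∃ m < n, ∃ i j, cnt z (j + m) + cnt z i + 2 ≤ cnt z (i + m) + cnt z j := by
  obtain ⟨i', hi', ei⟩ := hw i n (f 0 + 1)
  obtain ⟨j', hj', ej⟩ := hw j n (f 0 + 1)
  have hi := cnt_agree ei
  have hj := cnt_agree ej
  have h1 := cnt_add_le w i' n
  have h2 := cnt_le_add w i' n
  have h2' := cnt_le_add w j' n
  set r := n - (cnt w (i' + n) - cnt w i') with hr
  have zmono : ∀ a b, a ≤ b → a + cnt w b ≤ b + cnt w a := by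
    intro a b hab
    have := cnt_add_le w a (b - a)
    rw [Nat.add_sub_cancel' hab] at this
    omega
  obtain ⟨a, ha, ha'⟩ := C.locate (x := i' - 1) (by omega)
  obtain ⟨b, hb, hb'⟩ := C.locate (x := j' - 1) (by omega)
  have a0 := cnt_succ_false (C.apply_eq_false a)
  have b0 := cnt_succ_false (C.apply_eq_false b)
  have b1 := cnt_succ_false (C.apply_eq_false (b + 1))
  have ar := cnt_succ_false (C.apply_eq_false (a + (r + 1)))
  have wa1 := C.window' a 1
  have wb1 := C.window' b 1
  have wa := C.window' a (r + 1)
  have wb := C.window' (b + 1) (r + 1)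
  have za := zmono (f a + 1) i' (by omega)
  have zb := zmono j' (f (b + 1)) (by omega)
  have key1 : i' + n ≤ f (a + (r + 1)) := by
    by_contra! hc
    have := zmono (f (a + (r + 1)) + 1) (i' + n) hc
    have := zmono i' (f (a + 1)) (by omega)
    omega
  have key2 : f (b + 1 + (r + 1)) ≤ j' + n := by
    by_contra! hc
    have := zmono (j' + n) _ hc.le
    have := zmono (f b + 1) j' (by omega)
    omega
  have m1 := cnt_mono w key1
  have m2 := cnt_mono w key2
  have m3 := cnt_mono w (show f a ≤ i' by omega)
  have m4 := cnt_mono w (show j' ≤ f (b + 1) by omega)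
  refine ⟨r + 1, by omega, a, b + 1, by omega⟩

end IsolatedCoding

/-- The conclusion for words in which one of the two letters is isolated. -/
theorem bad_of_isolated (n : ℕ) : ∀ w : ℕ → Bool, Rec w →
    (∃ x, ∀ i, w i = x → w (i + 1) = !x) →
    (∃ i j, cnt w (j + n) + cnt w i + 2 ≤ cnt w (i + n) + cnt w j) → Bad w := by
  induction n using Nat.strong_induction_on with
  | _ n ih =>
  suffices main : ∀ w : ℕ → Bool, Rec w → (∀ i, w i = true → w (i + 1) = false) →
      (∃ i j, cnt w (j + n) + cnt w i + 2 ≤ cnt w (i + n) + cnt w j) → Bad w by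
    intro w hw hx hn
    obtain ⟨x, hx⟩ := hx
    cases x
    · refine Bad.of_swapLetters (main _ hw.swap (fun i hi => ?_) ?_)
      · simp only [swapLetters, Bool.not_eq_true'] at hi
        simp [swapLetters, hx i hi]
      · obtain ⟨i, j, hij⟩ := hn
        refine ⟨j, i, ?_⟩
        have h1 := cnt_swapLetters w i
        have h2 := cnt_swapLetters w j
        have h3 := cnt_swapLetters w (i + n)
        have h4 := cnt_swapLetters w (j + n)
        omega
    · exact main w hw hx hn
  intro w hw h11 hn
  obtain ⟨i, j, hij⟩ := hn
  obtain ⟨z, f, C, he⟩ := exists_isolatedCoding h11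
  have hz := C.recurrent hw he
  obtain ⟨m, hm, a, b, hab⟩ := C.unbalanced hw hij
  have hone : ∃ a, z a = true := by
    by_contra! hc
    have := cnt_add_false (w := z) (i := a) (n := m) fun t _ => by simpa using hc (a + t)
    have := cnt_le_add z b m
    omega
  by_cases hiso : ∃ x, ∀ i, z i = x → z (i + 1) = !x
  · exact C.bad hw hone (ih m hm z hz hiso ⟨a, b, hab⟩)
  push Not at hiso
  obtain ⟨p, hp, hp'⟩ := hiso false
  obtain ⟨q, hq, hq'⟩ := hiso true
  simp only [Bool.not_false, ne_eq, Bool.not_eq_true, Bool.not_true, Bool.not_eq_false] at hp' hq'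
  obtain ⟨A, hA⟩ := hz.exists_run (x := false) hq hp
  by_cases hex : ∃ k, Run z false k ∧ k ≠ A
  · obtain ⟨B, hB, hne⟩ := hex
    have hrun : ∀ k, Run z false k → Run w false (k + 1) := by
      rintro k ⟨hk, i, h1, h2, h3⟩
      have h5 : ∀ t ≤ k, f (i + 1 + t) = f (i + 1) + t := by
        intro t ht
        have := cnt_add_false (w := z) (i := i + 1) (n := t) fun s hs => h2 s (by omega)
        have := C.window' (i + 1) t
        omega
      have h6 := C.step₁ h1
      refine ⟨by omega, f i + 1, ?_, ?_, ?_⟩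
      · rw [← he]
        exact h1
      · intro t ht
        rw [show f i + 1 + 1 + t = f (i + 1 + t) by rw [h5 t (by omega)]; omega]
        exact C.apply_eq_false _
      · rw [show f i + 1 + 1 + (k + 1) = f (i + 1 + k) + 1 by rw [h5 k le_rfl]; omega, ← he]
        exact h3
    have hq1 := C.step₁ hq
    have r1 : Run w true 1 := by
      refine ⟨one_pos, f q, C.apply_eq_false q, fun t ht => ?_, ?_⟩
      · obtain rfl : t = 0 := by omega
        rw [add_zero, ← he, hq]
      · rw [show f q + 1 + 1 = f (q + 1) by omega]
        exact C.apply_eq_false _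
    have r2 : Run w false 1 := by
      refine ⟨one_pos, f q + 1, ?_, fun t ht => ?_, ?_⟩
      · rw [← he]
        exact hq
      · obtain rfl : t = 0 := by omega
        rw [show f q + 1 + 1 + 0 = f (q + 1) by omega]
        exact C.apply_eq_false _
      · rw [show f q + 1 + 1 + 1 = f (q + 1) + 1 by omega, ← he]
        exact hq'
    have := hA.1
    have := hB.1
    refine ⟨2, 1, two_pos, Or.inr fun i => ?_, Or.inl (Four.mk (ret_two_one_of_run_true r1)
      (ret_two_one_of_run_false r2) (ret_two_one_of_run_false (hrun A hA))
      (ret_two_one_of_run_false (hrun B hB)) ?_ ?_ ?_ ?_ ?_ ?_)⟩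
    · have h1 := cnt_succ w i
      have h2 := cnt_succ w (i + 1)
      have h3 := h11 i
      have h4 := Bool.toNat_le (w (i + 1))
      rw [show i + 2 = i + 1 + 1 from rfl]
      cases h : w i
      · simp only [h, Bool.toNat_false] at h1
        omega
      · simp only [h, Bool.toNat_true, h3 h, Bool.toNat_false] at h1 h2
        omega
    all_goals omega
  · push Not at hex
    refine C.bad hw hone (bad_of_single_run hz ?_ hA hex)
    by_contra! hc
    have := hA.1
    obtain rfl : A = 1 := by omega
    obtain ⟨y, hy, e⟩ := hz p 2 (q + 1)
    obtain ⟨k, k', hk1, hk2, hk3, hk4⟩ := exists_gap (P := fun t => z t = true) (n := 2) (i := y)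
      (a := q) (b := (hz.exists_eq q y).choose) hq (by omega) two_pos
      (fun t ht => by
        have := e t ht
        obtain rfl | rfl : t = 0 ∨ t = 1 := by omega
        · rw [add_zero, add_zero] at this
          simp [this, hp]
        · simp [this, hp'])
      (by rw [(hz.exists_eq q y).choose_spec.2, hq]) (hz.exists_eq q y).choose_spec.1
    have := hex (k' - k - 1) ⟨by omega, k, hk1, fun t ht => by
      simpa using hk4 (k + 1 + t) (by omega) (by omega), by
      rw [show k + 1 + (k' - k - 1) = k' by omega]
      exact hk2⟩
    omega

theorem occ_three {w : ℕ → Bool} {c i : ℕ} :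
    Occ w 3 c i ↔ (w i).toNat + (w (i + 1)).toNat + (w (i + 2)).toNat = c := by
  unfold Occ
  rw [show i + 3 = i + 1 + 1 + 1 from rfl, cnt_succ, cnt_succ, cnt_succ]
  omega

theorem Rec.run_ge {w : ℕ → Bool} (hw : Rec w) {x : Bool} {k : ℕ} (h : Run w x k) (N : ℕ) :
    ∃ i, N ≤ i ∧ w i = !x ∧ (∀ t < k, w (i + 1 + t) = x) ∧ w (i + 1 + k) = !x := by
  obtain ⟨hk, i, h1, h2, h3⟩ := h
  obtain ⟨j, hj, e⟩ := hw i (k + 2) N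
  refine ⟨j, hj, (e 0 (by omega)).trans h1, fun t ht => ?_, ?_⟩
  · rw [add_assoc, e (1 + t) (by omega), ← add_assoc, h2 t ht]
  · rw [add_assoc, e (1 + k) (by omega), ← add_assoc, h3]

theorem ret_three_of_run_false {w : ℕ → Bool} {k : ℕ} (h : Run w false k) (hk : 2 ≤ k) :
    Ret w 3 1 (k - 1) 1 := by
  obtain ⟨-, i, h1, h2, h3⟩ := h
  simp only [Bool.not_false] at h1 h3
  obtain ⟨k, rfl⟩ : ∃ m, k = m + 2 := ⟨k - 2, by omega⟩
  have h4 : cnt w (i + 1 + k) = cnt w (i + 1) := cnt_add_false fun t ht => h2 t (by omega)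
  have h5 := cnt_succ_true h1
  rw [show k + 2 - 1 = k + 1 by omega]
  refine ⟨i, ⟨occ_three.2 ?_, occ_three.2 ?_, by omega, ?_⟩, ?_⟩
  · have h6 := h2 0 (by omega)
    have h7 := h2 1 (by omega)
    rw [add_zero] at h6
    rw [show i + 1 + 1 = i + 2 from rfl] at h7
    simp [h1, h6, h7]
  · have h6 := h2 k (by omega)
    have h7 := h2 (k + 1) (by omega)
    rw [show i + 1 + k = i + (k + 1) by omega] at h6
    rw [show i + 1 + (k + 1) = i + (k + 1) + 1 by omega] at h7
    rw [show i + 1 + (k + 2) = i + (k + 1) + 2 by omega] at h3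
    simp [h3, h6, h7]
  · intro m hm hm' ho
    rw [occ_three] at ho
    have h6 := h2 (m - (i + 1)) (by omega)
    have h7 := h2 (m + 1 - (i + 1)) (by omega)
    have h8 := h2 (m + 2 - (i + 1)) (by omega)
    rw [Nat.add_sub_cancel' (by omega)] at h6 h7 h8
    simp [h6, h7, h8] at ho
  · rw [show i + (k + 1) = i + 1 + k by omega]
    omega

theorem ret_three_of_run_true {w : ℕ → Bool} (hw : Rec w)
    (hz : ∀ i, w i = true → w (i + 1) = false → w (i + 2) = false) {l : ℕ} (h : Run w true l)
    (hl : 2 ≤ l) : Ret w 3 1 (l + 1) (l - 1) := by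
  obtain ⟨i, hi, h1, h2, h3⟩ := hw.run_ge h 1
  obtain ⟨i, rfl⟩ : ∃ m, i = m + 1 := ⟨i - 1, by omega⟩
  obtain ⟨l, rfl⟩ : ∃ m, l = m + 2 := ⟨l - 2, by omega⟩
  simp only [Bool.not_true] at h1 h3
  have h4 := h2 0 (by omega)
  have h5 : w i = false := by
    by_contra hc
    rw [Bool.not_eq_false] at hc
    have := hz i hc h1
    rw [show i + 2 = i + 1 + 1 + 0 by omega, h4] at this
    simp at this
  have h6 := h2 (l + 1) (by omega)
  have h7 := hz (i + 1 + 1 + (l + 1)) h6 (by rwa [show i + 1 + 1 + (l + 1) + 1 =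
    i + 1 + 1 + (l + 2) by omega])
  have h8 : cnt w (i + 1 + 1 + (l + 1)) = cnt w (i + 1 + 1) + (l + 1) :=
    cnt_add_true fun t ht => h2 t (by omega)
  have h9 := cnt_succ_false h1
  have h10 := cnt_succ_false h5
  refine ⟨i, ⟨occ_three.2 ?_, occ_three.2 ?_, by omega, ?_⟩, ?_⟩
  · rw [show i + 1 + 1 + 0 = i + 2 by omega] at h4
    simp [h1, h4, h5]
  · rw [show i + 1 + 1 + (l + 1) = i + (l + 2 + 1) by omega] at h6 h7
    rw [show i + 1 + 1 + (l + 2) = i + (l + 2 + 1) + 1 by omega] at h3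
    simp [h3, h6, h7]
  · intro m hm hm' ho
    rw [occ_three] at ho
    rcases Nat.lt_or_ge m (i + (l + 2)) with hlt | hge
    · have h11 := h2 (m + 1 - (i + 2)) (by omega)
      have h12 := h2 (m + 2 - (i + 2)) (by omega)
      rw [show i + 1 + 1 = i + 2 from rfl, Nat.add_sub_cancel' (by omega)] at h11 h12
      simp [h11, h12] at ho
    · have h11 := h2 (m - (i + 2)) (by omega)
      have h12 := h2 (m + 1 - (i + 2)) (by omega)
      rw [show i + 1 + 1 = i + 2 from rfl, Nat.add_sub_cancel' (by omega)] at h11 h12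
      simp only [h11, h12, Bool.toNat_true] at ho
      omega
  · rw [show i + (l + 2 + 1) = i + 1 + 1 + (l + 1) by omega]
    omega

theorem ret_three_of_run_true_one {w : ℕ → Bool} (hw : Rec w)
    (hz : ∀ i, w i = true → w (i + 1) = false → w (i + 2) = false) (h : Run w true 1) :
    Ret w 3 1 1 0 := by
  obtain ⟨i, hi, h1, h2, h3⟩ := hw.run_ge h 1
  obtain ⟨i, rfl⟩ : ∃ m, i = m + 1 := ⟨i - 1, by omega⟩
  simp only [Bool.not_true] at h1 h3
  have h4 : w (i + 2) = true := h2 0 one_pos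
  have h5 : w i = false := by
    by_contra hc
    rw [Bool.not_eq_false] at hc
    have := hz i hc h1
    rw [h4] at this
    simp at this
  exact ret_one_of_false (occ_three.2 (by simp [h1, h4, h5]))
    (occ_three.2 (by simp [show w (i + 1 + 1) = true from h4, h1,
      show w (i + 1 + 2) = false from h3])) h5

theorem run_false_eq_four {w : ℕ → Bool} (hw : Rec w) (h : ¬ Four w 3 1)
    (h0 : ∀ j, Run w false j → 2 ≤ j) {k l : ℕ} (r2 : Run w false 2) (rk : Run w false k)
    (hk : k ≠ 2) (t2 : Run w true 2) (tl : Run w true l) (hl : l ≠ 2) : k = 4 := by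
  have hz : ∀ i, w i = true → w (i + 1) = false → w (i + 2) = false := by
    intro i h1 h2
    obtain ⟨m, hm, h3, -⟩ := hw.run_at (x := false) h1 h2
    exact h3 1 (h0 m hm)
  have hk' := h0 k rk
  by_contra hne
  have e1 := ret_three_of_run_false r2 le_rfl
  have e2 := ret_three_of_run_false rk hk'
  have e3 := ret_three_of_run_true hw hz t2 le_rfl
  have hl0 := tl.1
  rcases Nat.lt_or_ge l 2 with hlt | hge
  · obtain rfl : l = 1 := by omega
    refine h (Four.mk e1 e2 e3 (ret_three_of_run_true_one hw hz tl) ?_ ?_ ?_ ?_ ?_ ?_) <;> omega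
  · refine h (Four.mk e1 e2 e3 (ret_three_of_run_true hw hz tl hge) ?_ ?_ ?_ ?_ ?_ ?_) <;> omega

/-- No abelian class has four abelian returns or a single semi-abelian return. -/
def Good (w : ℕ → Bool) : Prop := ∀ L c, 0 < L → ¬ Four w L c ∧ ¬ Single w L c

theorem Good.swap {w : ℕ → Bool} (h : Good w) : Good (swapLetters w) := by
  intro L c hL
  constructor <;> intro hb
  · obtain ⟨i, hi⟩ := hb.exists_occ
    exact (h L (L - c) hL).1 (hb.of_swapLetters (by have := hi.le; omega))
  · obtain ⟨i, hi⟩ := hb.1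
    exact (h L (L - c) hL).2 (hb.of_swapLetters (by have := hi.le; omega))

theorem Good.not_bad {w : ℕ → Bool} (h : Good w) : ¬ Bad w := by
  rintro ⟨L, c, hL, -, hb | hb⟩
  exacts [(h L c hL).1 hb, (h L c hL).2 hb]

theorem Good.run_two {w : ℕ → Bool} (h : Good w) {k k' l l' : ℕ}
    (hk : Run w false k) (hk' : Run w false k') (hkk : k ≠ k') (hl : Run w true l)
    (hl' : Run w true l') (hll : l ≠ l') : Run w false 2 ∧ Run w true 2 := by
  have hd : (k = 2 ∨ k' = 2) ∧ (l = 2 ∨ l' = 2) := by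
    by_contra hc
    refine (h 2 1 two_pos).1 (Four.mk (ret_two_one_of_run_false hk) (ret_two_one_of_run_false hk')
      (ret_two_one_of_run_true hl) (ret_two_one_of_run_true hl') ?_ ?_ ?_ ?_ ?_ ?_) <;> omega
  obtain ⟨rfl | rfl, rfl | rfl⟩ := hd <;> constructor <;> assumption

theorem Good.run_false_eq {w : ℕ → Bool} (h : Good w) {k j l : ℕ} (h2 : Run w false 2)
    (hk : Run w false k) (hk2 : k ≠ 2) (hl : Run w true l) (hl2 : l ≠ 2) (hj : Run w false j) :
    j = 2 ∨ j = k := by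
  by_contra hc
  have := hl.1
  refine (h 2 1 two_pos).1 (Four.mk (ret_two_one_of_run_false h2) (ret_two_one_of_run_false hk)
      (ret_two_one_of_run_false hj) (ret_two_one_of_run_true hl) ?_ ?_ ?_ ?_ ?_ ?_) <;> omega

theorem Good.run_lengths_false {w : ℕ → Bool} (h : Good w) (hw : Rec w) {k l : ℕ}
    (r2 : Run w false 2) (hk : Run w false k) (hk2 : k ≠ 2) (t2 : Run w true 2)
    (hl : Run w true l) (hl2 : l ≠ 2) :
    ∃ a, (a = 1 ∨ a = 2) ∧ Run w false a ∧ Run w false (2 * a) ∧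
      ∀ j, Run w false j → j = a ∨ j = 2 * a := by
  have hall := fun j hj => h.run_false_eq (j := j) r2 hk hk2 hl hl2 hj
  have hk0 := hk.1
  rcases Nat.lt_or_ge k 2 with hlt | hge
  · obtain rfl : k = 1 := by omega
    exact ⟨1, Or.inl rfl, hk, r2, fun j hj => (hall j hj).symm⟩
  · obtain rfl := run_false_eq_four hw (h 3 1 (by omega)).1
      (fun j hj => by have := hall j hj; omega) r2 hk hk2 t2 hl hl2
    exact ⟨2, Or.inr rfl, r2, hk, hall⟩

theorem Good.run_lengths {w : ℕ → Bool} (h : Good w) (hw : Rec w) {k k' l l' : ℕ}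
    (hk : Run w false k) (hk' : Run w false k') (hkk : k ≠ k') (hl : Run w true l)
    (hl' : Run w true l') (hll : l ≠ l') :
    ∃ u : Bool → ℕ, ∀ x, (u x = 1 ∨ u x = 2) ∧ Run w x (u x) ∧ Run w x (2 * u x) ∧
      ∀ j, Run w x j → j = u x ∨ j = 2 * u x := by
  obtain ⟨r2, t2⟩ := h.run_two hk hk' hkk hl hl' hll
  obtain ⟨m, hm, hm2⟩ : ∃ m, Run w false m ∧ m ≠ 2 := by
    by_cases h1 : k = 2
    exacts [⟨k', hk', by omega⟩, ⟨k, hk, h1⟩]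
  obtain ⟨n, hn, hn2⟩ : ∃ m, Run w true m ∧ m ≠ 2 := by
    by_cases h1 : l = 2
    exacts [⟨l', hl', by omega⟩, ⟨l, hl, h1⟩]
  obtain ⟨a, ha⟩ := h.run_lengths_false hw r2 hm hm2 t2 hn hn2
  obtain ⟨b, hb⟩ := h.swap.run_lengths_false hw.swap (run_swapLetters.2 t2)
    (run_swapLetters.2 hn) hn2 (run_swapLetters.2 r2) (run_swapLetters.2 hm) hm2
  simp only [run_swapLetters, Bool.not_false] at hb
  exact ⟨fun x => if x then b else a, fun x => by cases x <;> simpa⟩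

/-- The word `w` is coded by `v`, with each letter `x` standing for `u x` letters `x`. -/
abbrev UnitCoding (v w : ℕ → Bool) (f : ℕ → ℕ) (u : Bool → ℕ) : Prop :=
  Coding v w f (u false) (u true) (fun _ => false) (fun _ => true)

/-- Starting points of the images of the letters in a `UnitCoding`. -/
def unitStart (w : ℕ → Bool) (u : Bool → ℕ) (p : ℕ) : ℕ → ℕ
  | 0 => p
  | j + 1 => unitStart w u p j + u (w (unitStart w u p j))

theorem exists_unitCoding {w : ℕ → Bool} (hw : Rec w) {u : Bool → ℕ} {i : ℕ}
    (hu : ∀ x, 0 < u x) (h : ∀ x k, Run w x k → k = u x ∨ k = 2 * u x)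
    (hi : w (i + 1) = !w i) :
    ∃ v f, UnitCoding v w f u ∧ ∀ j, v j = w (f j) := by
  set f := unitStart w u (i + 1) with hf
  have hs : ∀ j, f (j + 1) = f j + u (w (f j)) := fun j => rfl
  let I : ℕ → Prop := fun q => ∃ s, w s = !w q ∧ (q = s + 1 ∨ q = s + 1 + u (w q)) ∧
    ∀ t, s < t → t ≤ q → w t = w q
  have key : ∀ q, I q → (∀ t < u (w q), w (q + t) = w q) ∧ I (q + u (w q)) := by
    rintro q ⟨s, h1, h2, h3⟩
    have hq := hu (w q)
    obtain ⟨k, hk, h4, h5⟩ := hw.run_at (x := w q) h1 (h3 (s + 1) (by omega) (by omega))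
    set x := w q with hx
    have h4' : ∀ y, s < y → y < s + 1 + k → w y = x := fun y hy hy' => by
      have := h4 (y - (s + 1)) (by omega)
      rwa [Nat.add_sub_cancel' (by omega)] at this
    have hend : ∀ y, y = s + 1 + k → I y := by
      rintro y rfl
      have hk0 := hk.1
      refine ⟨s + k, ?_, Or.inl (by omega), fun t ht ht' => ?_⟩
      · rw [h5, h4' _ (by omega) (by omega), Bool.not_not]
      · rw [show t = s + 1 + k by omega]
    rcases h2 with h2 | h2
    · refine ⟨fun t ht => h4' _ (by omega) ?_, ?_⟩
      · rcases h x k hk with h | h <;> omega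
      · rcases h x k hk with h | h
        · exact hend _ (by omega)
        · have h6 : w (q + u x) = x := h4' _ (by omega) (by omega)
          refine ⟨s, by rw [h6, h1], Or.inr (by rw [h6]; omega), fun t ht ht' => ?_⟩
          rw [h6]
          exact h4' t ht (by omega)
    · have h6 : s + 1 + u x < s + 1 + k := by
        by_contra! hc
        have h7 : k = u x := by
          rcases h x k hk with h | h <;> omega
        rw [h7, ← h2, ← hx] at h5
        cases x <;> simp at h5
      have h7 : k = 2 * u x := by
        rcases h x k hk with h | h <;> omega
      exact ⟨fun t ht => h4' _ (by omega) (by omega), hend _ (by omega)⟩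
  have main : ∀ j, I (f j) := by
    intro j
    induction j with
    | zero => exact ⟨i, by rw [show f 0 = i + 1 from rfl, hi, Bool.not_not], Or.inl rfl,
        fun t ht ht' => by rw [show t = f 0 from le_antisymm ht' ht]⟩
    | succ j ih => exact (key _ ih).2
  refine ⟨fun j => w (f j), f, ⟨hu _, hu _, ?_, ?_, ?_, ?_⟩, fun j => rfl⟩
  · intro j hj
    rw [hs, hj]
  · intro j hj
    rw [hs, hj]
  · intro j t hj ht
    rw [(key _ (main j)).1 t (by rwa [hj]), hj]
  · intro j t hj ht
    rw [(key _ (main j)).1 t (by rwa [hj]), hj]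

/-- Runs of length at most `K` exclude `K + 1` equal letters in a row. -/
theorem Rec.exists_ne {w : ℕ → Bool} (hw : Rec w) {x : Bool} {K a : ℕ} (ha : w a = !x)
    (h : ∀ k, Run w x k → k ≤ K) (i : ℕ) : ∃ t ≤ K, w (i + t) = !x := by
  by_contra! hc
  obtain ⟨y, hy, e⟩ := hw i (K + 1) a
  obtain ⟨b, hb, e'⟩ := hw.exists_eq a y
  obtain ⟨k, k', h1, h2, h3, h4⟩ := exists_gap (P := fun t => w t = !x) (n := K + 1) ha hy
    K.succ_pos (fun t ht => by
      rw [e t ht]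
      exact hc t (by omega)) (e'.trans ha) hb
  have := h (k' - k - 1) ⟨by omega, k, h1, fun t ht => by
    have := h4 (k + 1 + t) (by omega) (by omega)
    cases x <;> simpa using this, by
    rw [show k + 1 + (k' - k - 1) = k' by omega]
    exact h2⟩
  omega

theorem eq_of_unit_counts {u : Bool → ℕ} (hu : ∀ x, u x = 1 ∨ u x = 2) {x x' : Bool}
    {R S r s t t' : ℕ} (ht : t < u x) (ht' : t' < u x')
    (h : R * u false + S * u true + t' = r * u false + s * u true + t)
    (h' : S * u true + t' * x'.toNat = s * u true + t * x.toNat) :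
    R = r ∧ S = s ∧ (t = 0 ∨ x' = x) := by
  rcases hu false with e | e <;> rcases hu true with e' | e' <;> cases x <;> cases x' <;>
    simp only [e, e', Bool.toNat_true, Bool.toNat_false] at ht ht' h h' <;>
    refine ⟨by omega, by omega, ?_⟩ <;> simp <;> omega

namespace UnitCoding

variable {v w : ℕ → Bool} {f : ℕ → ℕ} {u : Bool → ℕ}

theorem pos (C : UnitCoding v w f u) (x : Bool) : 0 < u x := by
  cases x
  exacts [C.pos₀, C.pos₁]

theorem apply_succ (C : UnitCoding v w f u) (j : ℕ) : f (j + 1) = f j + u (v j) := by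
  cases h : v j
  exacts [C.step₀ h, C.step₁ h]

theorem letter (C : UnitCoding v w f u) {j t : ℕ} (ht : t < u (v j)) : w (f j + t) = v j := by
  cases h : v j <;> rw [h] at ht
  exacts [C.letter₀ h ht, C.letter₁ h ht]

theorem apply_eq (C : UnitCoding v w f u) (j : ℕ) : w (f j) = v j :=
  C.letter (t := 0) (C.pos _)

theorem boundary (C : UnitCoding v w f u) {x : ℕ} (hx : f 0 ≤ x) (h : w x ≠ w (x + 1)) :
    ∃ j, x + 1 = f (j + 1) ∧ v j = w x := by
  obtain ⟨j, h1, h2⟩ := C.locate hx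
  have h3 := C.apply_succ j
  have h4 := C.letter (j := j) (t := x - f j) (by omega)
  rw [Nat.add_sub_cancel' h1] at h4
  refine ⟨j, ?_, h4.symm⟩
  by_contra hne
  have h5 := C.letter (j := j) (t := x + 1 - f j) (by omega)
  rw [Nat.add_sub_cancel' (by omega)] at h5
  exact h (h4.trans h5.symm)

theorem run (C : UnitCoding v w f u) (hw : Rec w) {x : Bool} {m : ℕ}
    (h : Run w x (m * u x)) : Run v x m := by
  obtain ⟨i, hi, h1, h2, h3⟩ := hw.run_ge h (f 0)
  have hu := C.pos x
  have hm : 0 < m := Nat.pos_of_mul_pos_right h.1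
  obtain ⟨j, hj, hj'⟩ := C.boundary hi (by
    have := h2 0 h.1
    rw [add_zero] at this
    rw [h1, this]
    cases x <;> simp)
  have key : ∀ t ≤ m, f (j + 1 + t) = i + 1 + t * u x ∧ ∀ s < t, v (j + 1 + s) = x := by
    intro t
    induction t with
    | zero => simp [hj]
    | succ t ih =>
      intro ht
      obtain ⟨h4, h5⟩ := ih (by omega)
      have h6 : v (j + 1 + t) = x := by
        rw [← C.apply_eq, h4]
        exact h2 _ (Nat.mul_lt_mul_of_pos_right (by omega) hu)
      refine ⟨?_, fun s hs => ?_⟩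
      · rw [← add_assoc, C.apply_succ, h4, h6]
        ring
      · rcases Nat.lt_succ_iff_lt_or_eq.1 hs with hs | rfl
        exacts [h5 s hs, h6]
  obtain ⟨h4, h5⟩ := key m le_rfl
  refine ⟨hm, j, hj'.trans h1, h5, ?_⟩
  rw [← C.apply_eq, h4, h3]

theorem recurrent (C : UnitCoding v w f u) (hw : Rec w)
    (h : ∀ j, ∃ m, (∀ t < m, v (j + t) = v j) ∧ v (j + m) = !v j) : Rec v := by
  have hback : ∀ x m y j, f 0 ≤ y → (∀ t < m * u x, w (y + t) = x) → y + m * u x = f j →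
      ∃ j', y = f j' := by
    intro x m
    induction m with
    | zero => exact fun y j _ _ hj => ⟨j, by simpa using hj⟩
    | succ m ih =>
      intro y j hy h1 h2
      have hu := C.pos x
      rw [Nat.succ_mul] at h1 h2
      obtain ⟨j', hj'⟩ := ih (y + u x) j (by omega)
        (fun t ht => by rw [add_assoc]; exact h1 _ (by omega)) (by omega)
      cases j' with
      | zero => omega
      | succ j' =>
        have h3 := C.apply_succ j'
        have h4 := C.pos (v j')
        have h5 := C.letter (j := j') (t := u (v j') - 1) (by omega)
        have h6 := h1 (u x - 1) (by omega)
        rw [show y + (u x - 1) = f j' + (u (v j') - 1) by omega, h5] at h6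
        rw [h6] at h3
        exact ⟨j', by omega⟩
  refine Coding.recurrent C hw (e := 0) (fun j => (C.apply_eq j).symm) fun j => ?_
  obtain ⟨m, h1, h2⟩ := h j
  have hm : m ≠ 0 := by
    rintro rfl
    simp at h2
  have hu := C.pos (v j)
  have key : ∀ t ≤ m, f (j + t) = f j + t * u (v j) ∧ ∀ s < t * u (v j), w (f j + s) = v j := by
    intro t
    induction t with
    | zero => simp
    | succ t ih =>
      intro ht
      obtain ⟨h3, h4⟩ := ih (by omega)
      refine ⟨?_, fun s hs => ?_⟩
      · rw [← add_assoc, C.apply_succ, h3, h1 t (by omega)]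
        ring
      · rcases Nat.lt_or_ge s (t * u (v j)) with hlt | hge
        · exact h4 s hlt
        · rw [Nat.succ_mul] at hs
          have := C.letter (j := j + t) (t := s - t * u (v j)) (by rw [h1 t (by omega)]; omega)
          rwa [h3, h1 t (by omega), show f j + t * u (v j) + (s - t * u (v j)) = f j + s by omega]
            at this
  obtain ⟨h3, h4⟩ := key m le_rfl
  have h5 : 0 < m * u (v j) := Nat.mul_pos (by omega) hu
  refine ⟨m * u (v j) + 1, fun y hy e => ?_⟩
  have h6 := e (m * u (v j) - 1) (by omega)
  have h7 := e (m * u (v j)) (by omega)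
  rw [h4 _ (by omega)] at h6
  rw [← h3, C.apply_eq, h2] at h7
  obtain ⟨j', hj', -⟩ := C.boundary (x := y + (m * u (v j) - 1)) (by omega) (by
    rw [h6, show y + (m * u (v j) - 1) + 1 = y + m * u (v j) by omega, h7]
    simp)
  refine hback (v j) m y (j' + 1) hy (fun t ht => ?_) (by omega)
  rw [e t (by omega), h4 t ht]

theorem exists_change (C : UnitCoding v w f u) {j : ℕ} (hj : v j = v (j + 1))
    (h : ∀ i, ∃ t ≤ 2 * u (v j), w (i + t) = !v j) : v (j + 2) = !v j := by
  obtain ⟨t, ht, h1⟩ := h (f j)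
  have h2 := C.apply_succ j
  have h3 := C.apply_succ (j + 1)
  have h4 := C.pos (v j)
  rw [← hj] at h3
  by_contra hc
  have h5 : v (j + 2) = v j := by
    cases h5 : v (j + 2) <;> cases h6 : v j <;> simp_all
  rcases Nat.lt_or_ge t (u (v j)) with hlt | hge
  · rw [C.letter hlt] at h1
    simp at h1
  · rcases Nat.lt_or_ge t (2 * u (v j)) with hlt | hge'
    · have := C.letter (j := j + 1) (t := t - u (v j)) (by rw [← hj]; omega)
      rw [← hj, show f (j + 1) + (t - u (v j)) = f j + t by omega, h1] at this
      simp at this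
    · have := C.apply_eq (j + 2)
      rw [show f (j + 2) = f j + t by rw [show j + 2 = j + 1 + 1 from rfl]; omega, h1, h5] at this
      simp at this

theorem cnt_offset (C : UnitCoding v w f u) {j t : ℕ} (ht : t ≤ u (v j)) :
    cnt w (f j + t) = cnt w (f j) + t * (v j).toNat := by
  cases h : v j
  · rw [cnt_add_false fun k hk => by rw [C.letter (by omega), h]]
    simp
  · rw [cnt_add_true fun k hk => by rw [C.letter (by omega), h]]
    simp

theorem window (C : UnitCoding v w f u) {j m R S : ℕ} (h : Occ v m S j) (hm : R + S = m) :
    f (j + m) = f j + R * u false + S * u true ∧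
      cnt w (f (j + m)) = cnt w (f j) + S * u true := by
  refine ⟨C.apply_add h hm, ?_⟩
  have h1 : cnt (fun _ => false) (u false) = 0 := by
    simpa [cnt] using @cnt_add_false (fun _ => false) 0 (u false) (by simp)
  have h2 : cnt (fun _ => true) (u true) = u true := by
    simpa [cnt] using @cnt_add_true (fun _ => true) 0 (u true) (by simp)
  rw [C.cnt_apply_add h hm, h1, h2]
  ring

theorem occ_iff (C : UnitCoding v w f u) (hu : ∀ x, u x = 1 ∨ u x = 2) {r s x : ℕ}
    (hx : f 0 ≤ x) : Occ w (r * u false + s * u true) (s * u true) x ↔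
      ∃ j t, x = f j + t ∧ t < u (v j) ∧ Occ v (r + s) s j ∧
        (t = 0 ∨ Occ v (r + s) s (j + 1)) := by
  constructor
  · intro ho
    obtain ⟨j, h1, h2⟩ := C.locate hx
    obtain ⟨m, h3, h4⟩ := C.locate (x := x + (r * u false + s * u true)) (by omega)
    have hjm : j ≤ m := by
      by_contra! hc
      have := C.strictMono.monotone (show m + 1 ≤ j from hc)
      omega
    obtain ⟨n, rfl⟩ := Nat.exists_eq_add_of_le hjm
    have h5 := cnt_add_le v j n
    have h6 := cnt_le_add v j n
    obtain ⟨S, hS⟩ := Nat.exists_eq_add_of_le h6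
    obtain ⟨R, rfl⟩ : ∃ R, n = R + S := ⟨n - S, by omega⟩
    obtain ⟨h7, h8⟩ := C.window (R := R) hS rfl
    obtain ⟨t, rfl⟩ := Nat.exists_eq_add_of_le h1
    obtain ⟨t', ht'⟩ := Nat.exists_eq_add_of_le h3
    rw [C.apply_succ] at h2 h4
    have h9 := C.cnt_offset (j := j) (t := t) (by omega)
    have h10 := C.cnt_offset (j := j + (R + S)) (t := t') (by omega)
    unfold Occ at ho
    rw [ht', h10, h9, h8] at ho
    have hv := cnt_succ v j
    have hv' := cnt_succ v (j + (R + S))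
    have key := eq_of_unit_counts hu (R := R) (S := S) (r := r) (s := s) (t := t) (t' := t')
      (x := v j) (x' := v (j + (R + S))) (by omega) (by omega) (by omega) (by omega)
    obtain ⟨rfl, rfl, h11⟩ := key
    refine ⟨j, t, rfl, by omega, hS, h11.imp id fun h11 => ?_⟩
    unfold Occ
    rw [h11] at hv'
    rw [show j + 1 + (R + S) = j + (R + S) + 1 by omega]
    omega
  · rintro ⟨j, t, rfl, h1, h2, h3⟩
    obtain ⟨h4, h5⟩ := C.window (R := r) h2 rfl
    have h6 := C.cnt_offset (j := j) (t := t) h1.le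
    have hv : t = 0 ∨ v (j + (r + s)) = v j := by
      refine h3.imp id fun h3 => ?_
      unfold Occ at h2 h3
      have hv := cnt_succ v j
      have hv' := cnt_succ v (j + (r + s))
      rw [show j + 1 + (r + s) = j + (r + s) + 1 by omega] at h3
      cases hj : v j <;> cases hj' : v (j + (r + s)) <;>
        simp only [hj, hj', Bool.toNat_true, Bool.toNat_false] at * <;> omega
    have h7 : cnt w (f (j + (r + s)) + t) = cnt w (f (j + (r + s))) + t * (v j).toNat := by
      rcases hv with rfl | hv
      · simp
      · rw [C.cnt_offset (by rw [hv]; omega), hv]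
    unfold Occ
    rw [show f j + t + (r * u false + s * u true) = f (j + (r + s)) + t by omega]
    omega

theorem cons (C : UnitCoding v w f u) (hu : ∀ x, u x = 1 ∨ u x = 2) {r s i j : ℕ}
    (h : Cons v (r + s) s i j) (hij : i + 2 ≤ j) :
    Cons w (r * u false + s * u true) (s * u true) (f i) (f j) := by
  obtain ⟨h1, h2, -, h3⟩ := h
  have h0 := C.strictMono.monotone (Nat.zero_le i)
  have h4 := C.strictMono (show i < j by omega)
  refine ⟨(C.occ_iff hu h0).2 ⟨i, 0, rfl, C.pos _, h1, Or.inl rfl⟩,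
    (C.occ_iff hu (by omega)).2 ⟨j, 0, rfl, C.pos _, h2, Or.inl rfl⟩, h4, ?_⟩
  intro x hx hx' ho
  obtain ⟨k, t, rfl, h5, h6, h7⟩ := (C.occ_iff hu (by omega)).1 ho
  have hkj : k < j := C.strictMono.lt_iff_lt.1 (show f k < f j by omega)
  have hik : i ≤ k := by
    by_contra! hc
    have h8 := C.strictMono.monotone (show k + 1 ≤ i from hc)
    have h9 := C.apply_succ k
    omega
  rcases hik.eq_or_lt with rfl | hik
  · exact h3 (i + 1) (by omega) (by omega) (h7.resolve_left (by omega))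
  · exact h3 k hik hkj h6

theorem ret (C : UnitCoding v w f u) (hu : ∀ x, u x = 1 ∨ u x = 2) {r s l k : ℕ}
    (h : Ret v (r + s) s l k) (hl : 2 ≤ l) :
    Ret w (r * u false + s * u true) (s * u true) ((l - k) * u false + k * u true)
      (k * u true) := by
  have hk := h.le
  obtain ⟨i, h1, h2⟩ := h
  obtain ⟨h3, h4⟩ := C.window (R := l - k) h2 (by omega)
  have := Ret.of_cons (C.cons hu h1 (by omega)) h4
  rwa [h3, show f i + (l - k) * u false + k * u true - f i = (l - k) * u false + k * u true by
    omega] at this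

theorem ret_one (C : UnitCoding v w f u) (hu : ∀ x, u x = 1 ∨ u x = 2) {r s k : ℕ}
    (h : Ret v (r + s) s 1 k) : Ret w (r * u false + s * u true) (s * u true) 1 k := by
  obtain ⟨i, ⟨h1, h2, -, -⟩, h3⟩ := h
  have h0 := C.strictMono.monotone (Nat.zero_le i)
  have h4 := (C.occ_iff hu h0).2 ⟨i, 0, rfl, C.pos _, h1, Or.inl rfl⟩
  have h5 : Occ w (r * u false + s * u true) (s * u true) (f i + 1) := by
    rcases (show u (v i) = 1 ∨ 1 < u (v i) by have := C.pos (v i); omega) with h | h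
    · refine (C.occ_iff hu (by omega)).2 ⟨i + 1, 0, ?_, C.pos _, h2, Or.inl rfl⟩
      rw [C.apply_succ, h, add_zero]
    · exact (C.occ_iff hu (by omega)).2 ⟨i, 1, rfl, h, h1, Or.inr h2⟩
  refine ⟨f i, cons_succ h4 h5, ?_⟩
  rw [cnt_succ, C.apply_eq]
  rw [cnt_succ] at h3
  omega

theorem good (C : UnitCoding v w f u) (hu : ∀ x, u x = 1 ∨ u x = 2) (hv : Rec v)
    (h : Good w) (hne : ∃ i j, v i ≠ v j) : Good v := by
  intro L c hL
  by_cases hcL : c ≤ L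
  swap
  · constructor <;> intro hb
    · obtain ⟨i, hi⟩ := hb.exists_occ
      exact hcL hi.le
    · obtain ⟨i, hi⟩ := hb.1
      exact hcL hi.le
  obtain ⟨r, rfl⟩ : ∃ r, L = r + c := ⟨L - c, by omega⟩
  have h0 := hu false
  have h1 := hu true
  have hpos : 0 < r * u false + c * u true := by
    rcases h0 with h0 | h0 <;> rcases h1 with h1 | h1 <;> rw [h0, h1] <;> omega
  refine ⟨fun hf => (h _ (c * u true) hpos).1 (hf.map (fun l k => if l = 1 then (1, k) else
    ((l - k) * u false + k * u true, k * u true)) ?_ ?_), ?_⟩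
  · intro l k hr
    have := hr.pos
    by_cases hl : l = 1
    · subst hl
      simpa using C.ret_one hu hr
    · simpa [hl] using C.ret hu hr (by omega)
  · intro l k l' k' hk hk' e
    split_ifs at e <;> rcases h0 with h0 | h0 <;> rcases h1 with h1 | h1 <;>
      simp only [h0, h1, Prod.mk.injEq] at e <;> omega
  · rintro ⟨h2, N, d, hd, hper, hsp⟩
    have hd2 : 2 ≤ d := by
      by_contra! hc
      obtain rfl : d = 1 := by omega
      have hconst : ∀ n, v (N + n) = v N := by
        intro n
        induction n with
        | zero => rfl
        | succ n ih => rw [← ih, ← add_assoc, hper _ (by omega)]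
      obtain ⟨i, j, hij⟩ := hne
      obtain ⟨a, ha, e⟩ := hv.exists_eq i N
      obtain ⟨b, hb, e'⟩ := hv.exists_eq j N
      refine hij ?_
      rw [← e, ← e', ← Nat.add_sub_cancel' ha, ← Nat.add_sub_cancel' hb, hconst, hconst]
    refine (h _ (c * u true) hpos).2 (C.single (P := Occ v (r + c) c)
      (d := d) (N := N) (s := 0) (M := f N)
      hd hper hsp ?_ ?_)
    · obtain ⟨i, hi⟩ := h2
      exact ⟨f i, (C.occ_iff hu (C.strictMono.monotone (Nat.zero_le i))).2
        ⟨i, 0, rfl, C.pos _, hi, Or.inl rfl⟩⟩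
    · intro x hx ho
      obtain ⟨j, t, rfl, h3, h4, h5⟩ := (C.occ_iff hu
        ((C.strictMono.monotone (Nat.zero_le N)).trans hx)).1 ho
      refine ⟨j, h4, ?_⟩
      rcases h5 with rfl | h5
      · rfl
      · have hNj : N ≤ j := by
          by_contra! hc
          have h6 := C.strictMono.monotone (show j + 1 ≤ N from hc)
          rw [C.apply_succ] at h6
          omega
        have := hsp j (j + 1) hNj (by omega) h4 h5
        omega

end UnitCoding

theorem Good.ret_eq {w : ℕ → Bool} (h : Good w) {L c l k l' k' : ℕ} (hL : 0 < L)
    (h0 : Ret w L c 1 0) (h1 : Ret w L c 1 1) (hr : Ret w L c l k) (hr' : Ret w L c l' k')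
    (hl : 2 ≤ l) (hl' : 2 ≤ l') : l = l' ∧ k = k' := by
  by_contra hne
  refine (h L c hL).1 (Four.mk h0 h1 hr hr' ?_ ?_ ?_ ?_ ?_ ?_) <;> omega

theorem Rec.exists_cons {w : ℕ → Bool} (hw : Rec w) {L c i : ℕ} (h : Occ w L c i) :
    ∃ j, Cons w L c i j := by
  have hex : ∃ j, i + 1 ≤ j ∧ Occ w L c j := hw.exists_occ h (i + 1)
  classical
  obtain ⟨h1, h2⟩ := Nat.find_spec hex
  exact ⟨_, h, h2, h1, fun k hk hk' ho => Nat.find_min hex hk' ⟨hk, ho⟩⟩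

theorem Rec.exists_occ_not_succ {w : ℕ → Bool} (hw : Rec w) {L c c' i j : ℕ} (hc : c ≠ c')
    (hi : Occ w L c i) (hj : Occ w L c' j) : ∃ n, Occ w L c n ∧ ¬ Occ w L c (n + 1) := by
  by_contra! h
  obtain ⟨m, hm, hm'⟩ := hw.exists_occ hj i
  have : ∀ t, Occ w L c (i + t) := by
    intro t
    induction t with
    | zero => exact hi
    | succ t ih => exact h _ ih
  have := this (m - i)
  rw [Nat.add_sub_cancel' hm] at this
  unfold Occ at this hm'
  omega

/-- If both returns of length one occur, then the gaps between the blocks of consecutive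
occurrences of an abelian class all have the same length. -/
theorem Good.exists_gap_length {w : ℕ → Bool} (h : Good w) (hw : Rec w) {L c i : ℕ} (hL : 0 < L)
    (h0 : Ret w L c 1 0) (h1 : Ret w L c 1 1) (hi : Occ w L c i) (hi' : ¬ Occ w L c (i + 1)) :
    ∃ p, 1 ≤ p ∧ ∀ i, Occ w L c i → ¬ Occ w L c (i + 1) →
      (∀ t < p, ¬ Occ w L c (i + 1 + t)) ∧ Occ w L c (i + 1 + p) := by
  have key : ∀ i, Occ w L c i → ¬ Occ w L c (i + 1) → ∃ l k, Cons w L c i (i + l) ∧ 2 ≤ l ∧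
      Ret w L c l k := by
    intro i hi hi'
    obtain ⟨j, hj⟩ := hw.exists_cons hi
    have hij := hj.2.2.1
    have hne : j ≠ i + 1 := by
      rintro rfl
      exact hi' hj.2.1
    refine ⟨j - i, cnt w j - cnt w i, ?_, by omega, Ret.of_cons hj ?_⟩
    · rwa [Nat.add_sub_cancel' hij.le]
    · have := cnt_mono w hij.le
      omega
  obtain ⟨l, k, -, hl, hr⟩ := key i hi hi'
  refine ⟨l - 1, by omega, fun j hj hj' => ?_⟩
  obtain ⟨l', k', hc, hl', hr'⟩ := key j hj hj'
  obtain ⟨rfl, -⟩ := h.ret_eq hL h0 h1 hr hr' hl hl'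
  refine ⟨fun t ht => hc.2.2.2 _ (by omega) (by omega), ?_⟩
  rw [show j + 1 + (l - 1) = j + l by omega]
  exact hc.2.1

section

variable {v : ℕ → Bool}

theorem light_or_heavy (hn : ∀ i, v i = v (i + 1) → v (i + 2) = !v i) (i : ℕ) :
    Occ v 3 1 i ∨ Occ v 3 2 i := by
  have := hn i
  rw [occ_three, occ_three]
  cases h : v i <;> cases h' : v (i + 1) <;> cases h'' : v (i + 2) <;> simp_all

theorem occ_three_two_of_not (hn : ∀ i, v i = v (i + 1) → v (i + 2) = !v i) {i : ℕ}
    (h : ¬ Occ v 3 1 i) : Occ v 3 2 i :=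
  (light_or_heavy hn i).resolve_left h

theorem occ_three_one_of_not (hn : ∀ i, v i = v (i + 1) → v (i + 2) = !v i) {i : ℕ}
    (h : ¬ Occ v 3 2 i) : Occ v 3 1 i :=
  (light_or_heavy hn i).resolve_right h

theorem not_heavy {i : ℕ} (h : Occ v 3 1 i) : ¬ Occ v 3 2 i := by
  unfold Occ at *
  omega

theorem not_light {i : ℕ} (h : Occ v 3 2 i) : ¬ Occ v 3 1 i := by
  unfold Occ at *
  omega

theorem eq_not_of_eq (hn : ∀ i, v i = v (i + 1) → v (i + 2) = !v i) {i : ℕ}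
    (h : v (i + 1) = v (i + 2)) : v i = !v (i + 1) := by
  have := hn i
  cases h0 : v i <;> cases h1 : v (i + 1) <;> simp_all

theorem Good.ret_three_one_zero (hg : Good v) (hv : Rec v)
    (hn : ∀ i, v i = v (i + 1) → v (i + 2) = !v i)
    (h00 : ∃ i, v i = false ∧ v (i + 1) = false) (h11 : ∃ i, v i = true ∧ v (i + 1) = true)
    (h010 : ∃ i, v i = false ∧ v (i + 1) = true ∧ v (i + 2) = false) : Ret v 3 1 1 0 := by
  by_contra hc
  have b1 : ∀ i, v i = false → v (i + 1) = false → v (i + 2) = true → v (i + 3) = true := by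
    intro i h0 h1 h2
    by_contra h3
    rw [Bool.not_eq_true] at h3
    exact hc (ret_one_of_false (occ_three.2 (by simp [h0, h1, h2]))
      (occ_three.2 (by simp [add_assoc, h1, h2, h3])) h0)
  have b2 : ∀ i, v i = false → v (i + 1) = true → v (i + 2) = false → v (i + 3) = true := by
    intro i h0 h1 h2
    by_contra h3
    rw [Bool.not_eq_true] at h3
    exact hc (ret_one_of_false (occ_three.2 (by simp [h0, h1, h2]))
      (occ_three.2 (by simp [add_assoc, h1, h2, h3])) h0)
  have r0 : Ret v 3 2 1 0 := by
    obtain ⟨i, h0, h1⟩ := h11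
    obtain ⟨j, hj, e⟩ := hv i 2 1
    obtain ⟨j, rfl⟩ : ∃ m, j = m + 1 := ⟨j - 1, by omega⟩
    have e0 : v (j + 1) = true := (e 0 (by omega)).trans h0
    have e1 : v (j + 2) = true := (e 1 (by omega)).trans h1
    have e2 : v (j + 3) = false := by simpa [e0] using hn (j + 1) (e0.trans e1.symm)
    have e3 : v j = false := by simpa [e0] using eq_not_of_eq hn (e0.trans e1.symm)
    exact ret_one_of_false (occ_three.2 (by simp [e0, e1, e3]))
      (occ_three.2 (by simp [add_assoc, e0, e1, e2])) e3
  have r1 : Ret v 3 2 3 2 := by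
    obtain ⟨i, h0, h1⟩ := h00
    obtain ⟨j, hj, e⟩ := hv i 2 2
    obtain ⟨j, rfl⟩ : ∃ m, j = m + 2 := ⟨j - 2, by omega⟩
    have e2 : v (j + 2) = false := (e 0 (by omega)).trans h0
    have e3 : v (j + 3) = false := (e 1 (by omega)).trans h1
    have e4 : v (j + 4) = true := by simpa [e2] using hn (j + 2) (e2.trans e3.symm)
    have e1 : v (j + 1) = true := by
      simpa [e2] using eq_not_of_eq hn (i := j + 1) (e2.trans e3.symm)
    have e5 := b1 (j + 2) e2 e3 e4
    have e0 : v j = true := by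
      by_contra h
      rw [Bool.not_eq_true] at h
      have := b2 j h e1 e2
      simp [e3] at this
    refine ⟨j, ⟨occ_three.2 (by simp [e0, e1, e2]), occ_three.2 (by simp [add_assoc, e3, e4, e5]),
      by omega, fun k hk hk' => not_heavy (occ_three.2 ?_)⟩, occ_three.2 (by simp [e0, e1, e2])⟩
    obtain rfl | rfl : k = j + 1 ∨ k = j + 2 := by omega
    · simp [add_assoc, e1, e2, e3]
    · simp [add_assoc, e2, e3, e4]
  have r2 : Ret v 3 2 2 1 := by
    obtain ⟨i, h0, h1, h2⟩ := h010
    obtain ⟨j, hj, e⟩ := hv i 3 1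
    obtain ⟨j, rfl⟩ : ∃ m, j = m + 1 := ⟨j - 1, by omega⟩
    have e1 : v (j + 1) = false := (e 0 (by omega)).trans h0
    have e2 : v (j + 2) = true := (e 1 (by omega)).trans h1
    have e3 : v (j + 3) = false := (e 2 (by omega)).trans h2
    have e4 := b2 (j + 1) e1 e2 e3
    have e0 : v j = true := by
      by_contra h
      rw [Bool.not_eq_true] at h
      have := b1 j h e1 e2
      simp [e3] at this
    refine ⟨j, ⟨occ_three.2 (by simp [e0, e1, e2]),
      occ_three.2 (by simp [add_assoc, e2, e3, show v (j + 4) = true from e4]),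
      by omega, fun k hk hk' => not_heavy (occ_three.2 ?_)⟩, ?_⟩
    · obtain rfl : k = j + 1 := by omega
      simp [add_assoc, e1, e2, e3]
    · rw [show j + 2 = j + 1 + 1 from rfl, cnt_succ_false e1, cnt_succ_true e0]
  have r3 : ¬ Ret v 3 2 1 1 := fun h => by
    have := hg.ret_eq three_pos r0 h r1 r2 (by omega) (by omega)
    omega
  have b3 : ∀ i, v i = true → v (i + 1) = true → v (i + 2) = false → v (i + 3) = false := by
    intro i h0 h1 h2
    by_contra h3
    rw [Bool.not_eq_false] at h3
    exact r3 (ret_one_of_true (occ_three.2 (by simp [h0, h1, h2]))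
      (occ_three.2 (by simp [add_assoc, h1, h2, h3])) h0)
  obtain ⟨i, h0, h1⟩ := h00
  have key : ∀ t, v (i + t + 2) = !v (i + t) := by
    intro t
    induction t with
    | zero => exact hn i (h0.trans h1.symm)
    | succ t ih =>
      have c1 := b1 (i + t)
      have c3 := b3 (i + t)
      have c5 := hn (i + t + 1)
      rw [show i + (t + 1) + 2 = i + t + 3 by omega, show i + (t + 1) = i + t + 1 by omega]
      cases e0 : v (i + t) <;> cases e1 : v (i + t + 1) <;> cases e3 : v (i + t + 3) <;>
        simp_all [add_assoc]
  obtain ⟨m, f0, f1, f2⟩ := h010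
  obtain ⟨j, hj, e⟩ := hv m 3 i
  have := key (j - i)
  rw [Nat.add_sub_cancel' hj, e 2 (by omega), f2, show v j = false from (e 0 (by omega)).trans f0]
    at this
  simp at this

theorem occ_three_two_of_true (hn : ∀ i, v i = v (i + 1) → v (i + 2) = !v i) {i : ℕ}
    (h : v i = true ∧ v (i + 1) = true ∨ v (i + 1) = true ∧ v (i + 2) = true) :
    Occ v 3 2 i := by
  refine occ_three_two_of_not hn fun ho => ?_
  rw [occ_three] at ho
  rcases h with ⟨h, h'⟩ | ⟨h, h'⟩ <;> rw [h, h'] at ho <;>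
    simp only [Bool.toNat_true] at ho <;> omega

/-- A heavy window at `b` followed by a light one. -/
def Descent (v : ℕ → Bool) (b : ℕ) : Prop := Occ v 3 2 b ∧ Occ v 3 1 (b + 1)

/-- Light streaks have length `q` and heavy streaks have length `p`. -/
def Streaks (v : ℕ → Bool) (q p : ℕ) : Prop :=
  ∀ b, Descent v b → (∀ t, 1 ≤ t → t ≤ q → Occ v 3 1 (b + t)) ∧
    (∀ t, q < t → t ≤ q + p → Occ v 3 2 (b + t)) ∧ Descent v (b + (q + p))

theorem Good.exists_streaks (hg : Good v) (hv : Rec v)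
    (hn : ∀ i, v i = v (i + 1) → v (i + 2) = !v i)
    (h00 : ∃ i, v i = false ∧ v (i + 1) = false) (h11 : ∃ i, v i = true ∧ v (i + 1) = true)
    (l0 : Ret v 3 1 1 0) (k1 : Ret v 3 2 1 1) :
    ∃ p q b, 3 ≤ p ∧ 1 ≤ q ∧ Descent v b ∧ Streaks v q p := by
  have l1 : Ret v 3 1 1 1 := by
    obtain ⟨i, h0, h1⟩ := h00
    obtain ⟨j, hj, e⟩ := hv i 2 1
    obtain ⟨j, rfl⟩ : ∃ m, j = m + 1 := ⟨j - 1, by omega⟩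
    have e0 : v (j + 1) = false := (e 0 (by omega)).trans h0
    have e1 : v (j + 2) = false := (e 1 (by omega)).trans h1
    have e2 : v (j + 3) = true := by simpa [e0] using hn (j + 1) (e0.trans e1.symm)
    have e3 : v j = true := by simpa [e0] using eq_not_of_eq hn (e0.trans e1.symm)
    exact ret_one_of_true (occ_three.2 (by simp [e0, e1, e3]))
      (occ_three.2 (by simp [add_assoc, e0, e1, e2])) e3
  have k0 : Ret v 3 2 1 0 := by
    obtain ⟨i, h0, h1⟩ := h11
    obtain ⟨j, hj, e⟩ := hv i 2 1
    obtain ⟨j, rfl⟩ : ∃ m, j = m + 1 := ⟨j - 1, by omega⟩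
    have e0 : v (j + 1) = true := (e 0 (by omega)).trans h0
    have e1 : v (j + 2) = true := (e 1 (by omega)).trans h1
    have e2 : v (j + 3) = false := by simpa [e0] using hn (j + 1) (e0.trans e1.symm)
    have e3 : v j = false := by simpa [e0] using eq_not_of_eq hn (e0.trans e1.symm)
    exact ret_one_of_false (occ_three.2 (by simp [e0, e1, e3]))
      (occ_three.2 (by simp [add_assoc, e0, e1, e2])) e3
  obtain ⟨a, ha, -⟩ := id l0
  obtain ⟨b, hb, hb'⟩ := id k1
  obtain ⟨i, hi, hi'⟩ := hv.exists_occ_not_succ (by norm_num) ha.1 hb.1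
  obtain ⟨j, hj, hj'⟩ := hv.exists_occ_not_succ (by norm_num) hb.1 ha.1
  obtain ⟨p, hp, hp'⟩ := hg.exists_gap_length hv three_pos l0 l1 hi hi'
  obtain ⟨q, hq, hq'⟩ := hg.exists_gap_length hv three_pos k0 k1 hj hj'
  have h3 : ∃ n, ∀ t < 3, Occ v 3 2 (n + t) := by
    obtain ⟨n, hn1, e⟩ := hv b 4 1
    obtain ⟨n, rfl⟩ : ∃ m, n = m + 1 := ⟨n - 1, by omega⟩
    have f1 := occ_of_agree (c := 2) (i := b) (j := n + 1) (L := 3) fun k hk => e k (by omega)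
    have f2 := occ_of_agree (c := 2) (i := b + 1) (j := n + 1 + 1) (L := 3) fun k hk => by
      rw [add_assoc, add_assoc b]
      exact e (1 + k) (by omega)
    replace f1 := f1.1 hb.1
    replace f2 := f2.1 hb.2.1
    have f3 : v (n + 1) = true := by
      rw [cnt_succ] at hb'
      have := e 0 (by omega)
      rw [add_zero] at this
      rw [this, add_zero]
      cases h : v b
      · simp [h] at hb'
      · rfl
    by_cases f4 : v (n + 2) = true
    · refine ⟨n, fun t ht => ?_⟩
      obtain rfl | rfl | rfl : t = 0 ∨ t = 1 ∨ t = 2 := by omega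
      exacts [occ_three_two_of_true hn (Or.inr ⟨f3, f4⟩), f1, f2]
    · refine ⟨n + 1, fun t ht => ?_⟩
      obtain rfl | rfl | rfl : t = 0 ∨ t = 1 ∨ t = 2 := by omega
      · exact f1
      · exact f2
      · rw [Bool.not_eq_true] at f4
        rw [occ_three] at f2
        refine occ_three_two_of_true hn (Or.inl ?_)
        simp only [add_assoc, Nat.reduceAdd, f4] at f2 ⊢
        cases g : v (n + 3) <;> cases g' : v (n + 4) <;> simp_all
  refine ⟨p, q, j, ?_, hq, ⟨hj, occ_three_one_of_not hn hj'⟩, ?_⟩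
  · obtain ⟨n, hn3⟩ := h3
    obtain ⟨m, hm, e⟩ := hv n 6 a
    obtain ⟨y, hy, hy'⟩ := hv.exists_occ ha.1 m
    obtain ⟨x, x', hx, hx', hxx, hno⟩ := exists_gap (P := Occ v 3 1) ha.1 hm three_pos
      (fun t ht => not_light ((occ_of_agree fun k hk => by
        rw [add_assoc, add_assoc n]
        exact e (t + k) (by omega)).1 (hn3 t ht))) hy' hy
    obtain ⟨h4, h5⟩ := hp' x hx (hno _ (by omega) (by omega))
    by_contra! hlt
    exact hno _ (by omega) (by omega) h5
  · rintro c ⟨hc, hc'⟩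
    obtain ⟨h4, h5⟩ := hq' c hc (not_heavy hc')
    have h6 : Occ v 3 1 (c + q) := occ_three_one_of_not hn (by
      rw [show c + q = c + 1 + (q - 1) by omega]
      exact h4 _ (by omega))
    obtain ⟨h7, h8⟩ := hp' (c + q) h6 (not_light (by
      rwa [show c + q + 1 = c + 1 + q by omega]))
    have h9 : ∀ t, q < t → t ≤ q + p → Occ v 3 2 (c + t) := fun t ht ht' => by
      have := h7 (t - q - 1) (by omega)
      rw [show c + q + 1 + (t - q - 1) = c + t by omega] at this
      exact occ_three_two_of_not hn this
    refine ⟨fun t ht ht' => ?_, h9, h9 _ (by omega) le_rfl, ?_⟩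
    · have := h4 (t - 1) (by omega)
      rw [show c + 1 + (t - 1) = c + t by omega] at this
      exact occ_three_one_of_not hn this
    · rwa [show c + (q + p) + 1 = c + q + 1 + p by omega]

end

theorem periodic_of_sums {V : ℕ → ℤ} {N T : ℕ} (hV : ∀ i, 0 ≤ V i ∧ V i ≤ 1)
    (hs : ∀ n, N ≤ n →
      V (n + T) + V (n + T + 1) + V (n + T + 2) = V n + V (n + 1) + V (n + 2))
    (h0 : V (N + T) = V N) (h1 : V (N + T + T) = V (N + T)) (n : ℕ) (hn : N ≤ n) :
    V (n + T) = V n := by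
  obtain ⟨D, hD⟩ : ∃ D : ℕ → ℤ, ∀ i, D i = V (N + i + T) - V (N + i) := ⟨_, fun i => rfl⟩
  have d : ∀ i, D i + D (i + 1) + D (i + 2) = 0 := fun i => by
    have := hs (N + i) (by omega)
    simp only [hD]
    rw [show N + (i + 1) + T = N + i + T + 1 by omega,
      show N + (i + 2) + T = N + i + T + 2 by omega,
      ← add_assoc, ← add_assoc]
    omega
  have d3 : ∀ m i, D (i + 3 * m) = D i := by
    intro m
    induction m with
    | zero => simp
    | succ m ih =>
      intro i
      rw [← ih i, show i + 3 * (m + 1) = i + 3 * m + 3 by omega]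
      have e0 := d (i + 3 * m)
      have e1 := d (i + 3 * m + 1)
      simp only [add_assoc, Nat.reduceAdd] at e0 e1 ⊢
      omega
  have z0 : D 0 = 0 := by
    rw [hD]
    simpa using sub_eq_zero.2 h0
  have zT : D T = 0 := by
    rw [hD, h1, sub_self]
  have z1 : D 1 = 0 := by
    obtain ⟨m, rfl | rfl | rfl⟩ : ∃ m, T = 0 + 3 * m ∨ T = 1 + 3 * m ∨ T = 2 + 3 * m :=
      ⟨T / 3, by omega⟩
    · have e0 := d3 m 1
      have e1 := hD 1
      have e2 := hD (1 + 3 * m)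
      rw [show N + (1 + 3 * m) = N + 1 + (0 + 3 * m) by omega] at e2
      have b0 := hV (N + 1)
      have b1 := hV (N + 1 + (0 + 3 * m) + (0 + 3 * m))
      omega
    · rwa [d3] at zT
    · rw [d3] at zT
      have := d 0
      simp only [zero_add] at this
      omega
  have z : ∀ i, D i = 0 := by
    intro i
    obtain ⟨m, rfl | rfl | rfl⟩ : ∃ m, i = 0 + 3 * m ∨ i = 1 + 3 * m ∨ i = 2 + 3 * m :=
      ⟨i / 3, by omega⟩
    · rwa [d3]
    · rwa [d3]
    · rw [d3]
      have := d 0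
      simp only [zero_add] at this
      omega
  have := z (n - N)
  rw [hD, Nat.add_sub_cancel' hn] at this
  omega

section

variable {v : ℕ → Bool}

theorem add_le_cnt (hn : ∀ i, v i = v (i + 1) → v (i + 2) = !v i) (n k : ℕ) :
    cnt v n + k ≤ cnt v (n + 3 * k) := by
  induction k with
  | zero => rfl
  | succ k ih =>
    have := light_or_heavy hn (n + 3 * k)
    unfold Occ at this
    rw [show n + 3 * (k + 1) = n + 3 * k + 3 by omega]
    omega

theorem occ_three_one_of_cnt_le (hn : ∀ i, v i = v (i + 1) → v (i + 2) = !v i) {n k : ℕ}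
    (h : cnt v (n + 3 * k) ≤ cnt v n + k) (t : ℕ) (ht : t < k) : Occ v 3 1 (n + 3 * t) := by
  refine occ_three_one_of_not hn fun ho => ?_
  have h1 := add_le_cnt hn n t
  have h2 := add_le_cnt hn (n + 3 * t + 3) (k - t - 1)
  rw [show n + 3 * t + 3 + 3 * (k - t - 1) = n + 3 * k by omega] at h2
  unfold Occ at ho
  omega

theorem cnt_of_occ_three_one {n k : ℕ} (h : ∀ t < k, Occ v 3 1 (n + 3 * t)) :
    cnt v (n + 3 * k) = cnt v n + k := by
  induction k with
  | zero => rfl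
  | succ k ih =>
    rw [show n + 3 * (k + 1) = n + 3 * k + 3 by omega, h k (by omega),
      ih fun t ht => h t (by omega), add_assoc]

theorem eq_of_occ_three {n c : ℕ} (h : Occ v 3 c n) (h' : Occ v 3 c (n + 1)) :
    v (n + 3) = v n := by
  rw [occ_three] at h h'
  simp only [add_assoc, Nat.reduceAdd] at h'
  cases e : v n <;> cases e' : v (n + 3) <;> simp_all <;> omega

theorem eq_of_occ_three_chain {y m : ℕ} (h : ∀ t < m, Occ v 3 1 (y + 3 * t))
    (h' : ∀ t < m, Occ v 3 1 (y + 3 * t + 1)) : v (y + 3 * m) = v y := by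
  induction m with
  | zero => rfl
  | succ m ih =>
    rw [show y + 3 * (m + 1) = y + 3 * m + 3 by omega,
      eq_of_occ_three (h m (by omega)) (h' m (by omega)),
      ih (fun t ht => h t (by omega)) fun t ht => h' t (by omega)]

theorem Descent.eq {b : ℕ} (h : Descent v b) : v (b + 3) = false := by
  obtain ⟨h, h'⟩ := h
  rw [occ_three] at h h'
  simp only [add_assoc, Nat.reduceAdd] at h'
  cases e : v b <;> cases e' : v (b + 3) <;> simp_all <;> omega

namespace Streaks

variable {p q : ℕ}

theorem add_le (hs : Streaks v q p) {b b' : ℕ} (hb : Descent v b) (hb' : Descent v b')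
    (h : b < b') : b + (q + p) ≤ b' := by
  obtain ⟨h1, h2, -⟩ := hs b hb
  by_contra! hlt
  obtain ⟨t, rfl⟩ := Nat.exists_eq_add_of_lt h
  rw [add_assoc] at hb'
  rcases le_or_gt (t + 1) q with ht | ht
  · exact not_heavy (h1 (t + 1) (by omega) ht) hb'.1
  · exact not_light (h2 (t + 2) (by omega) (by omega)) hb'.2

theorem exists_descent (hs : Streaks v q p) (hp : 3 ≤ p) {b₀ n : ℕ} (hb : Descent v b₀)
    (hn : b₀ < n) : ∃ b, b₀ ≤ b ∧ Descent v b ∧ b < n ∧ n ≤ b + (q + p) := by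
  induction n, hn using Nat.le_induction with
  | base => exact ⟨b₀, le_rfl, hb, by omega, by omega⟩
  | succ n hn ih =>
    obtain ⟨b, h1, h2, h3, h4⟩ := ih
    rcases le_or_gt (n + 1) (b + (q + p)) with h5 | h5
    · exact ⟨b, h1, h2, by omega, h5⟩
    · exact ⟨b + (q + p), by omega, (hs b h2).2.2, by omega, by omega⟩

theorem occ_of_le (hs : Streaks v q p) {b n : ℕ} (hb : Descent v b) (h : b < n) (h' : n ≤ b + q) :
    Occ v 3 1 n := by
  have := (hs b hb).1 (n - b) (by omega) (by omega)
  rwa [Nat.add_sub_cancel' h.le] at this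

theorem add_le_of_occ (hs : Streaks v q p) (hp : 3 ≤ p) {b n k : ℕ} (hb : Descent v b)
    (h : n ≤ b + (q + p)) (hk : ∀ t < k + 1, Occ v 3 1 (n + 3 * t)) :
    n + 3 * k ≤ b + q := by
  have key : ∀ m, b + q < m → m ≤ b + (q + p) → ¬ Occ v 3 1 m := fun m h1 h2 => by
    have := (hs b hb).2.1 (m - b) (by omega) (by omega)
    rw [Nat.add_sub_cancel' (by omega)] at this
    exact not_light this
  induction k with
  | zero =>
    by_contra! hlt
    exact key n hlt h (hk 0 one_pos)
  | succ k ih =>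
    have := ih fun t ht => hk t (by omega)
    by_contra! hlt
    exact key (n + 3 * (k + 1)) hlt (by omega) (hk (k + 1) (by omega))

theorem periodic (hs : Streaks v q p) (hp : 3 ≤ p) (hq : 1 ≤ q) {b₀ : ℕ} (hb : Descent v b₀)
    (n : ℕ) (h : b₀ + q ≤ n) :
    v (n + (q + p)) = v n := by
  have low : ∀ b, Descent v b → v (b + q) = false := fun b hb => by
    obtain ⟨h1, h2, -⟩ := hs b hb
    replace h1 := h1 q hq le_rfl
    replace h2 := h2 (q + 1) (by omega) (by omega)
    rw [occ_three] at h1 h2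
    simp only [add_assoc, Nat.reduceAdd] at h1 h2
    cases e : v (b + q) <;> cases e' : v (b + (q + 3)) <;> simp_all
  have hb1 := (hs _ hb).2.2
  have hb2 := (hs _ hb1).2.2
  have key := periodic_of_sums (V := fun i => ((v i).toNat : ℤ)) (N := b₀ + q) (T := q + p)
    (fun i => by cases v i <;> simp) (fun m hm => ?_) ?_ ?_ n h
  · cases e : v (n + (q + p)) <;> cases e' : v n <;> simp_all
  · obtain ⟨b, -, h1, h2, h3⟩ := hs.exists_descent hp hb (n := m) (by omega)
    have hc : ∃ c, Occ v 3 c m ∧ Occ v 3 c (m + (q + p)) := by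
      obtain ⟨h4, h5, h6⟩ := hs b h1
      obtain ⟨h7, h8, -⟩ := hs _ h6
      obtain ⟨t, rfl⟩ := Nat.exists_eq_add_of_lt h2
      rw [add_assoc] at h3 ⊢
      rw [show b + (t + 1) + (q + p) = b + (q + p) + (t + 1) by omega]
      rcases le_or_gt (t + 1) q with ht | ht
      · exact ⟨1, h4 _ (by omega) ht, h7 _ (by omega) ht⟩
      · exact ⟨2, h5 _ ht (by omega), h8 _ ht (by omega)⟩
    obtain ⟨c, h4, h5⟩ := hc
    rw [occ_three] at h4 h5
    omega
  · rw [low _ hb, show b₀ + q + (q + p) = b₀ + (q + p) + q by omega, low _ hb1]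
  · rw [show b₀ + q + (q + p) = b₀ + (q + p) + q by omega, low _ hb1,
      show b₀ + (q + p) + q + (q + p) = b₀ + (q + p) + (q + p) + q by omega, low _ hb2]

theorem single_of_mod_one {m : ℕ} (hs : Streaks v (3 * m + 1) p)
    (hn : ∀ i, v i = v (i + 1) → v (i + 2) = !v i) (hp : 3 ≤ p) {b₀ : ℕ} (hb : Descent v b₀) :
    Single v (3 * (m + 1)) (m + 1) := by
  refine ⟨⟨b₀ + 1, cnt_of_occ_three_one fun t ht => hs.occ_of_le hb (by omega) (by omega)⟩,
    b₀ + (3 * m + 1), 3 * m + 1 + p, by omega, hs.periodic hp (by omega) hb, ?_⟩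
  have key : ∀ i, b₀ + (3 * m + 1) ≤ i → Occ v (3 * (m + 1)) (m + 1) i →
      ∃ b, Descent v b ∧ i = b + 1 := fun i hi ho => by
    obtain ⟨b, -, h1, h2, h3⟩ := hs.exists_descent hp hb (n := i) (by omega)
    have := hs.add_le_of_occ hp h1 h3 (k := m) (occ_three_one_of_cnt_le hn (le_of_eq ho))
    exact ⟨b, h1, by omega⟩
  intro i j hi hij hoi hoj
  obtain ⟨b, hb1, rfl⟩ := key i hi hoi
  obtain ⟨b', hb2, rfl⟩ := key j (by omega) hoj
  have := hs.add_le hb1 hb2 (by omega)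
  omega

theorem occ_iff {m : ℕ} (hs : Streaks v q p) {b n : ℕ} (hb : Descent v b) (h : b < n)
    (h' : n + 3 * m ≤ b + q) : Occ v (3 * m + 2) m n ↔ v (n + 2) = true := by
  have h1 : cnt v (n + 3 * (m + 1)) = cnt v n + (m + 1) :=
    cnt_of_occ_three_one fun t ht => hs.occ_of_le hb (by omega) (by omega)
  have h2 : v (n + 2 + 3 * m) = v (n + 2) :=
    eq_of_occ_three_chain (fun t ht => hs.occ_of_le hb (by omega) (by omega))
      fun t ht => hs.occ_of_le hb (by omega) (by omega)
  rw [show n + 3 * (m + 1) = n + 2 + 3 * m + 1 by omega, cnt_succ, h2] at h1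
  unfold Occ
  rw [show n + (3 * m + 2) = n + 2 + 3 * m by omega]
  cases e : v (n + 2) <;> simp [e] at h1 ⊢ <;> omega

theorem single_of_mod_ne_one {m : ℕ} (hs : Streaks v q p) (hqm : q = 3 * m + 2 ∨ q = 3 * m + 3)
    (hn : ∀ i, v i = v (i + 1) → v (i + 2) = !v i) (hp : 3 ≤ p) {b₀ : ℕ} (hb : Descent v b₀) :
    Single v (3 * m + 2) m := by
  have hper := hs.periodic hp (by omega) hb
  refine ⟨?_, b₀ + q, q + p, by omega, hper, ?_⟩
  · have h0 := hb.eq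
    have h1 := hs.occ_of_le hb (n := b₀ + 1) (by omega) (by omega)
    rcases hqm with h | h
    · have h2 : v (b₀ + q) = false := by
        have e1 := hs.occ_of_le hb (n := b₀ + q) (by omega) (by omega)
        have e2 := (hs _ hb).2.1 (q + 1) (by omega) (by omega)
        rw [occ_three] at e1 e2
        simp only [add_assoc, Nat.reduceAdd] at e1 e2
        cases e : v (b₀ + q) <;> cases e' : v (b₀ + (q + 3)) <;> simp_all
      have h3 : v (b₀ + 2 + 3 * m) = v (b₀ + 2) :=
        eq_of_occ_three_chain (fun t ht => hs.occ_of_le hb (by omega) (by omega))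
          fun t ht => hs.occ_of_le hb (by omega) (by omega)
      rw [show b₀ + 2 + 3 * m = b₀ + q by omega, h2] at h3
      have h4 : v (b₀ + 1 + 3) = v (b₀ + 1) :=
        eq_of_occ_three h1 (hs.occ_of_le hb (by omega) (by omega))
      refine ⟨b₀ + 2, (hs.occ_iff hb (by omega) (by omega)).2 ?_⟩
      rw [show b₀ + 2 + 2 = b₀ + 1 + 3 by omega, h4]
      rw [occ_three, show b₀ + 1 + 1 = b₀ + 2 by omega, show b₀ + 1 + 2 = b₀ + 3 by omega, h0,
        ← h3] at h1
      cases e : v (b₀ + 1) <;> simp_all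
    · have h2 := hs.occ_of_le hb (n := b₀ + 3) (by omega) (by omega)
      rw [occ_three, h0] at h2
      cases e : v (b₀ + 2 + 2)
      · refine ⟨b₀ + 3, (hs.occ_iff hb (by omega) (by omega)).2 ?_⟩
        rw [show b₀ + 3 + 1 = b₀ + 2 + 2 by omega, e] at h2
        cases e' : v (b₀ + 3 + 2) <;> simp_all
      · exact ⟨b₀ + 2, (hs.occ_iff hb (by omega) (by omega)).2 e⟩
  · have key : ∀ i, b₀ + q ≤ i → Occ v (3 * m + 2) m i →
        ∃ b, Descent v b ∧ (i = b + 2 ∧ v (b + 4) = true ∨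
          i = b + 3 ∧ v (b + 5) = true ∧ Occ v 3 1 (b + 3)) := fun i hi ho => by
      obtain ⟨b, -, h1, h2, h3⟩ := hs.exists_descent hp hb (n := i) (by omega)
      have h4 : cnt v (i + 3 * (m + 1)) ≤ cnt v i + (m + 1) := by
        have := cnt_add_le v (i + (3 * m + 2)) 1
        unfold Occ at ho
        rw [show i + (3 * m + 2) + 1 = i + 3 * (m + 1) by omega] at this
        omega
      have h5 := hs.add_le_of_occ hp h1 h3 (k := m) (occ_three_one_of_cnt_le hn h4)
      have h6 := (hs.occ_iff h1 h2 h5).1 ho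
      obtain rfl | rfl | rfl : i = b + 1 ∨ i = b + 2 ∨ i = b + 3 := by omega
      · rw [h1.eq] at h6
        cases h6
      · exact ⟨b, h1, Or.inl ⟨rfl, h6⟩⟩
      · exact ⟨b, h1, Or.inr ⟨rfl, h6, hs.occ_of_le h1 (by omega) (by omega)⟩⟩
    have no : ∀ b, Descent v b → v (b + 4) = true → v (b + 5) = true → ¬ Occ v 3 1 (b + 3) :=
      fun b hb h1 h2 h3 => by
        rw [occ_three, hb.eq, show b + 3 + 1 = b + 4 by omega, show b + 3 + 2 = b + 5 by omega,
          h1, h2] at h3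
        simp at h3
    intro i j hi hij hoi hoj
    by_contra! hlt
    have hoi' : Occ v (3 * m + 2) m (i + (q + p)) := (occ_of_agree fun k hk => by
      rw [← hper (i + k) (by omega)]
      congr 1
      omega).1 hoi
    obtain ⟨b, hb1, h1⟩ := key i hi hoi
    obtain ⟨b', hb2, h2⟩ := key j (by omega) hoj
    obtain ⟨b'', hb3, h3⟩ := key _ (by omega) hoi'
    have c1 := hs.add_le hb1 hb2
    have c2 := hs.add_le hb2 hb1
    have c3 := hs.add_le hb2 hb3
    have c4 := hs.add_le hb3 hb2
    rcases h1 with ⟨rfl, h1⟩ | ⟨rfl, h1, h1'⟩ <;> rcases h2 with ⟨rfl, h2⟩ | ⟨rfl, h2, h2'⟩ <;>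
      rcases h3 with ⟨h4, h3⟩ | ⟨h4, h3, h3'⟩ <;> try omega
    · obtain rfl : b = b' := by omega
      exact no b hb1 h1 h2 h2'
    · obtain rfl : b' = b'' := by omega
      exact no b' hb2 h2 h3 h3'

theorem exists_single (hs : Streaks v q p) (hn : ∀ i, v i = v (i + 1) → v (i + 2) = !v i)
    (hp : 3 ≤ p) (hq : 1 ≤ q) {b : ℕ} (hb : Descent v b) : ∃ L c, 0 < L ∧ Single v L c := by
  obtain ⟨m, rfl | h⟩ : ∃ m, q = 3 * m + 1 ∨ q = 3 * m + 2 ∨ q = 3 * m + 3 :=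
    ⟨(q - 1) / 3, by omega⟩
  · exact ⟨_, _, by omega, hs.single_of_mod_one hn hp hb⟩
  · exact ⟨_, _, by omega, hs.single_of_mod_ne_one h hn hp hb⟩

end Streaks

theorem Good.false_of_codes (hg : Good v) (hv : Rec v)
    (hn : ∀ i, v i = v (i + 1) → v (i + 2) = !v i)
    (h00 : ∃ i, v i = false ∧ v (i + 1) = false) (h11 : ∃ i, v i = true ∧ v (i + 1) = true)
    (h010 : ∃ i, v i = false ∧ v (i + 1) = true ∧ v (i + 2) = false)
    (h101 : ∃ i, v i = true ∧ v (i + 1) = false ∧ v (i + 2) = true) : False := by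
  have k1 : Ret v 3 2 1 1 := by
    refine Ret.of_swapLetters (c' := 1) (k := 0) (by norm_num)
      (hg.swap.ret_three_one_zero hv.swap (fun i => ?_) ?_ ?_ ?_)
    · simpa [swapLetters] using hn i
    · simpa [swapLetters] using h11
    · simpa [swapLetters] using h00
    · simpa [swapLetters] using h101
  obtain ⟨p, q, b, hp, hq, hb, hs⟩ := hg.exists_streaks hv hn h00 h11
    (hg.ret_three_one_zero hv hn h00 h11 h010) k1
  obtain ⟨L, c, hL, h⟩ := hs.exists_single hn hp hq hb
  exact (hg L c hL).2 h

end

theorem Good.exists_runs_false {w : ℕ → Bool} (h : Good w) (hw : Rec w) {a b : ℕ}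
    (ha : w a = true) (hb : w b = false) (hb' : w (b + 1) = false) :
    ∃ k k', Run w false k ∧ Run w false k' ∧ k ≠ k' := by
  obtain ⟨A, hA, hA2⟩ : ∃ A, Run w false A ∧ 2 ≤ A := by
    by_contra! hc
    obtain ⟨t, ht, e⟩ := hw.exists_ne (x := false) (K := 1) ha
      (fun k hk => Nat.le_of_lt_succ (hc k hk)) b
    obtain rfl | rfl : t = 0 ∨ t = 1 := by omega
    · rw [add_zero, hb] at e
      cases e
    · rw [hb'] at e
      cases e
  by_contra! hc
  exact h.not_bad (bad_of_single_run hw hA2 hA fun k hk => hc k A hk hA)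

theorem Good.exists_runs {w : ℕ → Bool} (h : Good w) (hw : Rec w) {x : Bool} {a b : ℕ}
    (ha : w a = !x) (hb : w b = x) (hb' : w (b + 1) = x) :
    ∃ k k', Run w x k ∧ Run w x k' ∧ k ≠ k' := by
  cases x
  · exact h.exists_runs_false hw ha hb hb'
  · obtain ⟨k, k', hk, hk', hne⟩ := h.swap.exists_runs_false hw.swap (a := a) (b := b)
      (by simp [swapLetters, ha]) (by simp [swapLetters, hb]) (by simp [swapLetters, hb'])
    exact ⟨k, k', run_swapLetters.1 hk, run_swapLetters.1 hk', hne⟩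

theorem Good.isolated {w : ℕ → Bool} (h : Good w) (hw : Rec w) :
    ∃ x, ∀ i, w i = x → w (i + 1) = !x := by
  by_contra! hc
  have hd : ∀ x, ∃ i, w i = x ∧ w (i + 1) = x := fun x => by
    obtain ⟨i, hi, hi'⟩ := hc x
    exact ⟨i, hi, by simpa using hi'⟩
  have hx : ∀ x, ∃ i, w i = x := fun x => (hd x).imp fun i hi => hi.1
  have hr : ∀ x, ∃ k k', Run w x k ∧ Run w x k' ∧ k ≠ k' := fun x => by
    obtain ⟨i, hi, hi'⟩ := hd x
    obtain ⟨a, ha⟩ := hx (!x)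
    exact h.exists_runs hw ha hi hi'
  obtain ⟨k, k', hk, hk', hkk⟩ := hr false
  obtain ⟨l, l', hl, hl', hll⟩ := hr true
  obtain ⟨u, hu⟩ := h.run_lengths hw hk hk' hkk hl hl' hll
  obtain ⟨a, ha⟩ := hx true
  obtain ⟨b, hb⟩ := hx false
  obtain ⟨i, -, hi, hi'⟩ := hw.exists_boundary (x := false) ha hb 0
  obtain ⟨v, f, C, -⟩ := exists_unitCoding hw (i := i)
    (fun x => by rcases (hu x).1 with h | h <;> omega) (fun x => (hu x).2.2.2)
    (by rw [hi, hi', Bool.not_not])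
  have hn : ∀ i, v i = v (i + 1) → v (i + 2) = !v i := fun i hi =>
    C.exists_change hi fun j => by
      obtain ⟨a, ha⟩ := hx (!v i)
      refine hw.exists_ne ha (fun k hk => ?_) j
      rcases (hu (v i)).2.2.2 k hk with h | h <;> omega
  have hv : Rec v := C.recurrent hw fun j => by
    by_cases hj : v j = v (j + 1)
    · refine ⟨2, fun t ht => ?_, hn j hj⟩
      obtain rfl | rfl : t = 0 ∨ t = 1 := by omega
      exacts [rfl, hj.symm]
    · exact ⟨1, fun t ht => by rw [Nat.lt_one_iff.1 ht, add_zero],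
        Bool.eq_not_of_ne (Ne.symm hj)⟩
  have r1 : ∀ x, ∃ i, v i = (!x) ∧ v (i + 1) = x ∧ v (i + 2) = !x := fun x => by
    obtain ⟨-, j, h1, h2, h3⟩ := C.run hw (x := x) (m := 1) (by rw [one_mul]; exact (hu x).2.1)
    exact ⟨j, h1, h2 0 one_pos, h3⟩
  have r2 : ∀ x, ∃ i, v i = x ∧ v (i + 1) = x := fun x => by
    obtain ⟨-, j, -, h2, -⟩ := C.run hw (hu x).2.2.1
    exact ⟨j + 1, h2 0 two_pos, h2 1 one_lt_two⟩
  have hg : Good v := C.good (fun x => (hu x).1) hv h (by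
    obtain ⟨j, h1, h2, -⟩ := r1 true
    exact ⟨j, j + 1, by rw [h1, h2]; decide⟩)
  exact hg.false_of_codes hv hn (r2 false) (r2 true) (r1 true) (r1 false)

/-- If every factor of a recurrent binary word has at most three abelian returns and at
least two semi-abelian returns, then the word is balanced. -/
theorem stmt10 (w : ℕ → Bool) (hrec : RecurrentW w)
    (h : ∀ u, IsFactorW w u → u ≠ [] →
      AtMostKAbReturns w u 3 ∧ AtLeastTwoSemiAbReturns w u) :
    CBalanced w 1 := by
  by_contra hb
  have hw := rec_of_recurrentW hrec
  have hg : Good w := fun L c hL =>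
    ⟨not_four_of_atMost (fun u hu hne => (h u hu hne).1) hL,
      not_single_of_atLeast hw (fun u hu hne => (h u hu hne).2) hL⟩
  obtain ⟨n, i, j, hn⟩ := exists_unbalanced hb
  exact hg.not_bad (bad_of_isolated n w hw (hg.isolated hw) ⟨j, i, by omega⟩)
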